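/- arXiv:math/0004175 — 2 statements merged into one kernel-verified Lean document; each statement's English description precedes it below -/
import Mathlib

section
/- Let k ≤ m ≤ n, let r_1,…,r_m and c_1,…,c_n be positive reals, and let X be a random exponential m×n matrix with rank 1 rate matrix A = (r_i c_j). Let (i_1,…,i_k) be a sequence of distinct elements of {1,…,m} and (j_1,…,j_k) a sequence of distinct elements of {1,…,n}. Then the probability that the flag of submatrices of X is given by these two sequences (i.e., for every l ≤ k, the unique minimum l-assignment of X uses exactly rows {i_1,…,i_l} and columns {j_1,…,j_l}) equals Pr(r,(i_1,…,i_k))·Pr(c,(j_1,…,j_k)). Furthermore, for subsets I ⊆ {1,…,m} and J ⊆ {1,…,n} each of size k, the probability that the minimum k-assignment of X uses exactly the rows indexed by I is Pr(r,I), the probability that it uses exactly the columns indexed by J is Pr(c,J), and these two events are independent. -/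
open MeasureTheory

/-- A `k`-assignment of an `m × n` matrix: a set of `k` positions,
no two in the same row or column. -/
def IsAssignF (m n k : ℕ) (S : Finset (Fin m × Fin n)) : Prop :=
  S.card = k ∧ ∀ p ∈ S, ∀ q ∈ S, p ≠ q → p.1 ≠ q.1 ∧ p.2 ≠ q.2

/-- `S` is a `k`-assignment of the matrix `x` achieving `min_k(x)`. -/
def MinAssignF (m n k : ℕ) (x : Fin m × Fin n → ℝ) (S : Finset (Fin m × Fin n)) : Prop :=
  IsAssignF m n k S ∧ ∀ T, IsAssignF m n k T → ∑ p ∈ S, x p ≤ ∑ p ∈ T, x p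

/-- The law of a random exponential `m × n` matrix with rank 1 rate matrix `(r i * c j)`:
the measure on `(Fin m × Fin n) → ℝ` with the product exponential density with respect
to Lebesgue measure. -/
noncomputable def rankOneMeasure (m n : ℕ) (r : Fin m → ℝ) (c : Fin n → ℝ) :
    Measure ((Fin m × Fin n) → ℝ) :=
  volume.withDensity fun x => ENNReal.ofReal
    (∏ p : Fin m × Fin n,
      if 0 ≤ x p then (r p.1 * c p.2) * Real.exp (-((r p.1 * c p.2) * x p)) else 0)

/-- `Pr(r, (i_1, …, i_k))`: the urn probability
`∏_{s=1}^{k} r_{i_s} / (R − ∑_{u<s} r_{i_u})` for a sequence `ι` of (distinct) indices. -/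
noncomputable def prSeq {m k : ℕ} (r : Fin m → ℝ) (ι : Fin k → Fin m) : ℝ :=
  ∏ s : Fin k,
    r (ι s) / ((∑ i, r i) - ∑ u ∈ Finset.univ.filter fun u => u < s, r (ι u))

/-- `Pr(r, I)`: the sum of `Pr(r, (i_1, …, i_t))` over all orderings of the set `I`. -/
noncomputable def prSet {m : ℕ} (r : Fin m → ℝ) (I : Finset (Fin m)) : ℝ :=
  ∑ ι : Fin I.card → Fin m,
    if Function.Injective ι ∧ Finset.univ.image ι = I then prSeq r ι else 0

lemma IsAssignF.eq_of_fst {m n k : ℕ} {S : Finset (Fin m × Fin n)} (hS : IsAssignF m n k S)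
    {p q : Fin m × Fin n} (hp : p ∈ S) (hq : q ∈ S) (h : p.1 = q.1) : p = q :=
  by_contra fun hne => (hS.2 p hp q hq hne).1 h

lemma IsAssignF.eq_of_snd {m n k : ℕ} {S : Finset (Fin m × Fin n)} (hS : IsAssignF m n k S)
    {p q : Fin m × Fin n} (hp : p ∈ S) (hq : q ∈ S) (h : p.2 = q.2) : p = q :=
  by_contra fun hne => (hS.2 p hp q hq hne).2 h

lemma IsAssignF.card_image_fst {m n k : ℕ} {S : Finset (Fin m × Fin n)}
    (hS : IsAssignF m n k S) : (S.image Prod.fst).card = k := by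
  rw [Finset.card_image_of_injOn, hS.1]
  exact fun p hp q hq h => hS.eq_of_fst hp hq h

/-- The bipartite graph on rows and columns whose edges are the positions in `E`. -/
def positionGraph {m n : ℕ} (E : Finset (Fin m × Fin n)) : SimpleGraph (Fin m ⊕ Fin n) :=
  SimpleGraph.fromRel fun a b => ∃ p ∈ E, a = .inl p.1 ∧ b = .inr p.2

/-- The connected component of `positionGraph E` containing the row of `p`. -/
def positionComponent {m n : ℕ} (E : Finset (Fin m × Fin n)) (p : Fin m × Fin n) :
    (positionGraph E).ConnectedComponent :=
  (positionGraph E).connectedComponentMk (.inl p.1)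

lemma positionGraph_adj_of_mem {m n : ℕ} {E : Finset (Fin m × Fin n)} {p : Fin m × Fin n}
    (hp : p ∈ E) : (positionGraph E).Adj (.inl p.1) (.inr p.2) := by
  rw [positionGraph, SimpleGraph.fromRel_adj]
  exact ⟨by simp, Or.inl ⟨p, hp, rfl, rfl⟩⟩

lemma positionComponent_eq_snd {m n : ℕ} {E : Finset (Fin m × Fin n)} {p : Fin m × Fin n}
    (hp : p ∈ E) :
    (positionGraph E).connectedComponentMk (.inr p.2) = positionComponent E p :=
  SimpleGraph.ConnectedComponent.sound (positionGraph_adj_of_mem hp).symm.reachable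

open Classical in
lemma ncard_supp_le {m n : ℕ} (E : Finset (Fin m × Fin n))
    (K : (positionGraph E).ConnectedComponent) :
    K.supp.ncard ≤ (E.filter fun p => positionComponent E p = K).card + 1 := by
  have h1 := K.connected_toSimpleGraph.card_vert_le_card_edgeSet_add_one
  have h2 : Nat.card K.toSimpleGraph.edgeSet ≤
      (E.filter fun p => positionComponent E p = K).card := by
    rw [← Nat.card_eq_finsetCard]
    let f : (E.filter fun p => positionComponent E p = K) → K.toSimpleGraph.edgeSet := fun p =>
      ⟨s(⟨.inl p.1.1, (Finset.mem_filter.1 p.2).2⟩,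
        ⟨.inr p.1.2, (positionComponent_eq_snd (Finset.mem_filter.1 p.2).1).trans
          (Finset.mem_filter.1 p.2).2⟩),
        (K.toSimpleGraph_adj _ _).2 (positionGraph_adj_of_mem (Finset.mem_filter.1 p.2).1)⟩
    refine Nat.card_le_card_of_surjective f ?_
    rintro ⟨e, he⟩
    induction e using Sym2.ind with
    | _ a b =>
      obtain ⟨a, ha⟩ := a
      obtain ⟨b, hb⟩ := b
      have hadj : (positionGraph E).Adj a b := (K.toSimpleGraph_adj ha hb).1 he
      rw [positionGraph, SimpleGraph.fromRel_adj] at hadj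
      rcases hadj.2 with ⟨p, hp, rfl, rfl⟩ | ⟨p, hp, rfl, rfl⟩
      · exact ⟨⟨p, Finset.mem_filter.2 ⟨hp, ha⟩⟩, rfl⟩
      · exact ⟨⟨p, Finset.mem_filter.2 ⟨hp, hb⟩⟩, Subtype.ext Sym2.eq_swap⟩
  have h3 : Nat.card K = K.supp.ncard := rfl
  omega

open Classical in
lemma two_mul_card_filter_le_card {m n k : ℕ} {E M : Finset (Fin m × Fin n)}
    (hM : IsAssignF m n k M) (K : (positionGraph E).ConnectedComponent)
    (W : Set (Fin m ⊕ Fin n)) (hW : ∀ p ∈ M, positionComponent E p = K →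
      Sum.inl p.1 ∈ W ∧ Sum.inr p.2 ∈ W) :
    2 * (M.filter fun p => positionComponent E p = K).card ≤ W.ncard := by
  set F := M.filter fun p => positionComponent E p = K
  have h1 : (F.image Prod.fst).card = F.card := Finset.card_image_of_injOn fun p hp q hq h =>
    hM.eq_of_fst (Finset.mem_filter.1 hp).1 (Finset.mem_filter.1 hq).1 h
  have h2 : (F.image Prod.snd).card = F.card := Finset.card_image_of_injOn fun p hp q hq h =>
    hM.eq_of_snd (Finset.mem_filter.1 hp).1 (Finset.mem_filter.1 hq).1 h
  have h3 : (((F.image Prod.fst).disjSum (F.image Prod.snd) : Finset _) :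
      Set (Fin m ⊕ Fin n)).ncard ≤ W.ncard := by
    refine Set.ncard_le_ncard ?_ (Set.toFinite _)
    intro v hv
    rw [Finset.mem_coe, Finset.mem_disjSum] at hv
    rcases hv with ⟨i, hi, rfl⟩ | ⟨j, hj, rfl⟩
    · obtain ⟨p, hp, rfl⟩ := Finset.mem_image.1 hi
      exact (hW p (Finset.mem_filter.1 hp).1 (Finset.mem_filter.1 hp).2).1
    · obtain ⟨p, hp, rfl⟩ := Finset.mem_image.1 hj
      exact (hW p (Finset.mem_filter.1 hp).1 (Finset.mem_filter.1 hp).2).2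
  rw [Set.ncard_coe_finset, Finset.card_disjSum, h1, h2] at h3
  omega

/-- Exchanging two assignments along a union of connected components of their union. -/
lemma IsAssignF.exchange {m n k l t : ℕ} {E M N : Finset (Fin m × Fin n)} (hME : M ⊆ E)
    (hNE : N ⊆ E) (hM : IsAssignF m n k M) (hN : IsAssignF m n l N)
    (P : (positionGraph E).ConnectedComponent → Prop) [DecidablePred P]
    (ht : (M.filter fun p => ¬ P (positionComponent E p)).card +
      (N.filter fun p => P (positionComponent E p)).card = t) :
    IsAssignF m n t ((M.filter fun p => ¬ P (positionComponent E p)) ∪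
      (N.filter fun p => P (positionComponent E p))) := by
  have key : ∀ p ∈ M, ¬ P (positionComponent E p) → ∀ q ∈ N, P (positionComponent E q) →
      p.1 ≠ q.1 ∧ p.2 ≠ q.2 := by
    intro p hp hPp q hq hPq
    refine ⟨fun h => hPp ?_, fun h => hPp ?_⟩
    · rwa [positionComponent, h]
    · rwa [← positionComponent_eq_snd (hME hp), h, positionComponent_eq_snd (hNE hq)]
  constructor
  · rw [Finset.card_union_of_disjoint, ht]
    rw [Finset.disjoint_left]
    intro p hp hq
    exact (Finset.mem_filter.1 hp).2 (Finset.mem_filter.1 hq).2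
  · intro p hp q hq hpq
    rw [Finset.mem_union, Finset.mem_filter, Finset.mem_filter] at hp hq
    rcases hp with hp | hp <;> rcases hq with hq | hq
    · exact hM.2 p hp.1 q hq.1 hpq
    · exact key p hp.1 hp.2 q hq.1 hq.2
    · have := key q hq.1 hq.2 p hp.1 hp.2
      exact ⟨this.1.symm, this.2.symm⟩
    · exact hN.2 p hp.1 q hq.1 hpq

/-- A matrix is generic if distinct sets of positions have distinct sums. -/
def GenericMatrix {m n : ℕ} (x : Fin m × Fin n → ℝ) : Prop :=
  ∀ S T : Finset (Fin m × Fin n), ∑ p ∈ S, x p = ∑ p ∈ T, x p → S = T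

lemma MinAssignF.eq {m n k : ℕ} {x : Fin m × Fin n → ℝ} (hx : GenericMatrix x)
    {S T : Finset (Fin m × Fin n)} (hS : MinAssignF m n k x S) (hT : MinAssignF m n k x T) :
    S = T :=
  hx S T (le_antisymm (hS.2 T hT.1) (hT.2 S hS.1))

lemma MinAssignF.filter_eq_of_card_eq {m n k l : ℕ} {x : Fin m × Fin n → ℝ}
    (hx : GenericMatrix x) {E M N : Finset (Fin m × Fin n)} (hME : M ⊆ E) (hNE : N ⊆ E)
    (hM : MinAssignF m n k x M) (hN : MinAssignF m n l x N)
    (P : (positionGraph E).ConnectedComponent → Prop) [DecidablePred P]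
    (hc : (M.filter fun p => P (positionComponent E p)).card =
      (N.filter fun p => P (positionComponent E p)).card) :
    (M.filter fun p => P (positionComponent E p)) =
      (N.filter fun p => P (positionComponent E p)) := by
  have cM := Finset.card_filter_add_card_filter_not (s := M) fun p => P (positionComponent E p)
  have cN := Finset.card_filter_add_card_filter_not (s := N) fun p => P (positionComponent E p)
  have sM := Finset.sum_filter_add_sum_filter_not M (fun p => P (positionComponent E p)) x
  have sN := Finset.sum_filter_add_sum_filter_not N (fun p => P (positionComponent E p)) x
  have hMk := hM.1.1
  have hNl := hN.1.1
  have h1 := hM.2 _ (hM.1.exchange hME hNE hN.1 P (t := k) (by omega))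
  have h2 := hN.2 _ (hN.1.exchange hNE hME hM.1 P (t := l) (by omega))
  have disj : ∀ A B : Finset (Fin m × Fin n),
      Disjoint (A.filter fun p => ¬ P (positionComponent E p))
        (B.filter fun p => P (positionComponent E p)) := by
    intro A B
    rw [Finset.disjoint_left]
    intro p hp hq
    exact (Finset.mem_filter.1 hp).2 (Finset.mem_filter.1 hq).2
  rw [Finset.sum_union (disj _ _)] at h1 h2
  exact hx _ _ (by linarith)

open Classical in
/-- Nesting property for rows. -/
lemma MinAssignF.image_fst_subset {m n l : ℕ} {x : Fin m × Fin n → ℝ} (hx : GenericMatrix x)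
    {M N : Finset (Fin m × Fin n)} (hM : MinAssignF m n l x M)
    (hN : MinAssignF m n (l + 1) x N) : M.image Prod.fst ⊆ N.image Prod.fst := by
  intro i hi
  by_contra hiN
  obtain ⟨p₀, hp₀, rfl⟩ := Finset.mem_image.1 hi
  set E := M ∪ N
  have hME : M ⊆ E := Finset.subset_union_left
  have hNE : N ⊆ E := Finset.subset_union_right
  have hp₀N : p₀ ∉ N := fun h => hiN (Finset.mem_image_of_mem _ h)
  let a : (positionGraph E).ConnectedComponent → ℕ := fun K =>
    (M.filter fun p => positionComponent E p = K).card
  let b : (positionGraph E).ConnectedComponent → ℕ := fun K =>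
    (N.filter fun p => positionComponent E p = K).card
  have hnot : ∀ P : (positionGraph E).ConnectedComponent → Prop, P (positionComponent E p₀) →
      (M.filter fun p => P (positionComponent E p)).card ≠
      (N.filter fun p => P (positionComponent E p)).card := by
    intro P hP hc
    have := hM.filter_eq_of_card_eq hx hME hNE hN P hc
    have h2 : p₀ ∈ M.filter fun p => P (positionComponent E p) :=
      Finset.mem_filter.2 ⟨hp₀, hP⟩
    rw [this] at h2
    exact hp₀N (Finset.mem_filter.1 h2).1
  have hEab : ∀ K, K.supp.ncard ≤ a K + b K + 1 := by
    intro K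
    refine (ncard_supp_le E K).trans ?_
    refine Nat.add_le_add_right ((Finset.card_le_card ?_).trans (Finset.card_union_le _ _)) 1
    intro p hp
    rw [Finset.mem_filter] at hp
    rw [Finset.mem_union, Finset.mem_filter, Finset.mem_filter]
    exact (Finset.mem_union.1 hp.1).imp (fun h => ⟨h, hp.2⟩) fun h => ⟨h, hp.2⟩
  have hW : ∀ p ∈ E, ∀ K, positionComponent E p = K →
      Sum.inl p.1 ∈ K.supp ∧ Sum.inr p.2 ∈ K.supp := by
    rintro p hp K rfl
    exact ⟨rfl, positionComponent_eq_snd hp⟩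
  have ha : ∀ K, 2 * a K ≤ K.supp.ncard := fun K =>
    two_mul_card_filter_le_card hM.1 K _ fun p hp h => hW p (hME hp) K h
  have hb : ∀ K, 2 * b K ≤ K.supp.ncard := fun K =>
    two_mul_card_filter_le_card hN.1 K _ fun p hp h => hW p (hNE hp) K h
  set K₀ := positionComponent E p₀ with hK₀
  have hb₀ : 2 * b K₀ + 1 ≤ K₀.supp.ncard := by
    have h1 : (Sum.inl p₀.1 : Fin m ⊕ Fin n) ∈ K₀.supp := rfl
    have h2 : 2 * b K₀ ≤ (K₀.supp \ {Sum.inl p₀.1}).ncard := by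
      refine two_mul_card_filter_le_card hN.1 K₀ _ fun p hp h => ?_
      obtain ⟨h3, h4⟩ := hW p (hNE hp) K₀ h
      refine ⟨⟨h3, fun h5 => hiN ?_⟩, ⟨h4, by simp⟩⟩
      rw [Set.mem_singleton_iff, Sum.inl.injEq] at h5
      rw [← h5]
      exact Finset.mem_image_of_mem _ hp
    have h3 := Set.ncard_sdiff_singleton_add_one h1 (Set.toFinite _)
    omega
  have hne₀ : a K₀ ≠ b K₀ := hnot (fun K => K = K₀) rfl
  have h₀ : a K₀ = b K₀ + 1 := by
    have := hEab K₀
    have := ha K₀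
    omega
  have hsum : ∀ S : Finset (Fin m × Fin n),
      S.card = ∑ K, (S.filter fun p => positionComponent E p = K).card :=
    fun S => Finset.card_eq_sum_card_fiberwise fun p _ => Finset.mem_coe.2 (Finset.mem_univ _)
  have hMsum : ∑ K, a K = l := by rw [← hM.1.1]; exact (hsum M).symm
  have hNsum : ∑ K, b K = l + 1 := by rw [← hN.1.1]; exact (hsum N).symm
  obtain ⟨K₁, hK₁⟩ : ∃ K₁, a K₁ < b K₁ := by
    by_contra! hcon
    have := Finset.sum_le_sum fun K (_ : K ∈ Finset.univ) => hcon K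
    omega
  have h₁ : b K₁ = a K₁ + 1 := by
    have := hEab K₁
    have := hb K₁
    omega
  have hne : K₀ ≠ K₁ := by
    rintro h
    rw [← h] at hK₁
    omega
  have hpair : ∀ S : Finset (Fin m × Fin n),
      (S.filter fun p => positionComponent E p = K₀ ∨ positionComponent E p = K₁).card =
      (S.filter fun p => positionComponent E p = K₀).card +
      (S.filter fun p => positionComponent E p = K₁).card := by
    intro S
    rw [Finset.filter_or, Finset.card_union_of_disjoint]
    rw [Finset.disjoint_left]
    intro p hp hq
    exact hne ((Finset.mem_filter.1 hp).2.symm.trans (Finset.mem_filter.1 hq).2)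
  have hcard : (M.filter fun p => positionComponent E p = K₀ ∨ positionComponent E p = K₁).card =
      (N.filter fun p => positionComponent E p = K₀ ∨ positionComponent E p = K₁).card := by
    rw [hpair, hpair]
    change a K₀ + a K₁ = b K₀ + b K₁
    omega
  refine hnot (fun K => K = K₀ ∨ K = K₁) (Or.inl rfl) ?_
  convert hcard

lemma exists_minAssignF {m n k : ℕ} (hm : k ≤ m) (hn : k ≤ n) (x : Fin m × Fin n → ℝ) :
    ∃ S, MinAssignF m n k x S := by
  classical
  have hne : (Finset.univ.filter fun S => IsAssignF m n k S).Nonempty := by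
    refine ⟨Finset.univ.image fun s : Fin k => (Fin.castLE hm s, Fin.castLE hn s), ?_⟩
    rw [Finset.mem_filter]
    refine ⟨Finset.mem_univ _, ?_, ?_⟩
    · rw [Finset.card_image_of_injective, Finset.card_univ, Fintype.card_fin]
      intro a b hab
      simpa using hab
    · intro p hp q hq hpq
      obtain ⟨a, -, rfl⟩ := Finset.mem_image.1 hp
      obtain ⟨b, -, rfl⟩ := Finset.mem_image.1 hq
      have : a ≠ b := fun h => hpq (by rw [h])
      simpa using this
  obtain ⟨S, hS, hmin⟩ := Finset.exists_min_image _ (fun S => ∑ p ∈ S, x p) hne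
  exact ⟨S, (Finset.mem_filter.1 hS).2,
    fun T hT => hmin T (Finset.mem_filter.2 ⟨Finset.mem_univ _, hT⟩)⟩

lemma IsAssignF.swap {m n k : ℕ} {S : Finset (Fin m × Fin n)} (hS : IsAssignF m n k S) :
    IsAssignF n m k (S.image Prod.swap) := by
  refine ⟨by rw [Finset.card_image_of_injective _ Prod.swap_injective, hS.1], ?_⟩
  intro p hp q hq hpq
  obtain ⟨p, hpS, rfl⟩ := Finset.mem_image.1 hp
  obtain ⟨q, hqS, rfl⟩ := Finset.mem_image.1 hq
  exact (hS.2 p hpS q hqS fun h => hpq (by rw [h])).symm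

lemma sum_image_swap {m n : ℕ} (S : Finset (Fin m × Fin n)) (x : Fin m × Fin n → ℝ) :
    ∑ p ∈ S.image Prod.swap, (x ∘ Prod.swap) p = ∑ p ∈ S, x p := by
  rw [Finset.sum_image fun p _ q _ h => Prod.swap_injective h]
  simp

lemma image_swap_swap {m n : ℕ} (S : Finset (Fin m × Fin n)) :
    (S.image Prod.swap).image Prod.swap = S := by
  simp [Finset.image_image]

lemma image_fst_image_swap {m n : ℕ} (S : Finset (Fin m × Fin n)) :
    (S.image Prod.swap).image Prod.fst = S.image Prod.snd := by
  simp [Finset.image_image, Function.comp_def]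

lemma image_snd_image_swap {m n : ℕ} (S : Finset (Fin m × Fin n)) :
    (S.image Prod.swap).image Prod.snd = S.image Prod.fst := by
  simp [Finset.image_image, Function.comp_def]

lemma MinAssignF.swap {m n k : ℕ} {x : Fin m × Fin n → ℝ} {S : Finset (Fin m × Fin n)}
    (hS : MinAssignF m n k x S) : MinAssignF n m k (x ∘ Prod.swap) (S.image Prod.swap) := by
  refine ⟨hS.1.swap, fun T hT => ?_⟩
  rw [sum_image_swap, ← image_swap_swap T, sum_image_swap]
  exact hS.2 _ hT.swap

lemma GenericMatrix.swap {m n : ℕ} {x : Fin m × Fin n → ℝ} (hx : GenericMatrix x) :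
    GenericMatrix (x ∘ Prod.swap : Fin n × Fin m → ℝ) := by
  intro S T h
  rw [← image_swap_swap S, ← image_swap_swap T, sum_image_swap, sum_image_swap] at h
  rw [← image_swap_swap S, hx _ _ h, image_swap_swap]

/-- Nesting property for columns. -/
lemma MinAssignF.image_snd_subset {m n l : ℕ} {x : Fin m × Fin n → ℝ} (hx : GenericMatrix x)
    {M N : Finset (Fin m × Fin n)} (hM : MinAssignF m n l x M)
    (hN : MinAssignF m n (l + 1) x N) : M.image Prod.snd ⊆ N.image Prod.snd := by
  have := hM.swap.image_fst_subset hx.swap hN.swap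
  rwa [image_fst_image_swap, image_fst_image_swap] at this

lemma MinAssignF.image_fst_subset_of_le {m n l k : ℕ} (hlk : l ≤ k) (hm : k ≤ m) (hn : k ≤ n)
    {x : Fin m × Fin n → ℝ} (hx : GenericMatrix x) {M N : Finset (Fin m × Fin n)}
    (hM : MinAssignF m n l x M) (hN : MinAssignF m n k x N) :
    M.image Prod.fst ⊆ N.image Prod.fst := by
  induction k, hlk using Nat.le_induction generalizing N with
  | base => rw [hM.eq hx hN]
  | succ k hlk ih =>
    obtain ⟨T, hT⟩ := exists_minAssignF (by omega : k ≤ m) (by omega : k ≤ n) x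
    exact (ih (by omega) (by omega) hT).trans (hT.image_fst_subset hx hN)

lemma IsAssignF.replace_row {m n k : ℕ} {S : Finset (Fin m × Fin n)} (hS : IsAssignF m n k S)
    {i i' : Fin m} {j : Fin n} (hp : (i, j) ∈ S) (hi' : i' ∉ S.image Prod.fst) :
    IsAssignF m n k (insert (i', j) (S.erase (i, j))) := by
  have hq : (i', j) ∉ S := fun h => hi' (Finset.mem_image_of_mem Prod.fst h)
  have key : ∀ p ∈ S.erase (i, j), (i', j).1 ≠ p.1 ∧ (i', j).2 ≠ p.2 := by
    intro p hp'
    rw [Finset.mem_erase] at hp'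
    refine ⟨fun h => hi' ?_, fun h => (hS.2 p hp'.2 (i, j) hp hp'.1).2 h.symm⟩
    change i' = p.1 at h
    rw [h]
    exact Finset.mem_image_of_mem _ hp'.2
  refine ⟨?_, ?_⟩
  · rw [Finset.card_insert_of_notMem fun h => hq (Finset.mem_of_mem_erase h),
      Finset.card_erase_add_one hp, hS.1]
  · intro p hp q hq hpq
    rcases Finset.mem_insert.1 hp with rfl | hp
    · rcases Finset.mem_insert.1 hq with rfl | hq
      · exact absurd rfl hpq
      · exact key q hq
    · rcases Finset.mem_insert.1 hq with rfl | hq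
      · exact ⟨(key p hp).1.symm, (key p hp).2.symm⟩
      · exact hS.2 p (Finset.mem_of_mem_erase hp) q (Finset.mem_of_mem_erase hq) hpq

lemma sum_insert_erase {α : Type*} [DecidableEq α] {S : Finset α} {p q : α} (hp : p ∈ S)
    (hq : q ∉ S) (y : α → ℝ) :
    ∑ a ∈ insert q (S.erase p), y a = y q + ∑ a ∈ S, y a - y p := by
  rw [Finset.sum_insert fun h => hq (Finset.mem_of_mem_erase h), ← Finset.add_sum_erase S y hp]
  ring

lemma image_snd_replace_row {m n : ℕ} {S : Finset (Fin m × Fin n)} {i i' : Fin m} {j : Fin n}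
    (hp : (i, j) ∈ S) :
    (insert (i', j) (S.erase (i, j))).image Prod.snd = S.image Prod.snd := by
  rw [Finset.image_insert, ← Finset.insert_erase hp, Finset.image_insert,
    Finset.erase_insert (Finset.notMem_erase _ _)]

lemma IsAssignF.image_fst_replace_row {m n k : ℕ} {S : Finset (Fin m × Fin n)}
    (hS : IsAssignF m n k S) {i i' : Fin m} {j : Fin n} (hp : (i, j) ∈ S) :
    (insert (i', j) (S.erase (i, j))).image Prod.fst = insert i' ((S.image Prod.fst).erase i) := by
  rw [Finset.image_insert]
  congr 1
  ext a
  simp only [Finset.mem_image, Finset.mem_erase]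
  constructor
  · rintro ⟨p, ⟨hne, hpS⟩, rfl⟩
    exact ⟨(hS.2 p hpS _ hp hne).1, p, hpS, rfl⟩
  · rintro ⟨hne, p, hpS, rfl⟩
    exact ⟨p, ⟨fun h => hne (by rw [h]), hpS⟩, rfl⟩

/-- The minimum `l`-assignments for `l ≤ k` span the rows `I l` and columns `J l`, and the minimum
`(k + 1)`-assignment spans the rows `A` and columns `B` and uses the position `p`. -/
def FlagStep {m n : ℕ} (I : ℕ → Finset (Fin m)) (J : ℕ → Finset (Fin n)) (k : ℕ)
    (A : Finset (Fin m)) (B : Finset (Fin n)) (p : Fin m × Fin n) (x : Fin m × Fin n → ℝ) : Prop :=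
  (∀ l ≤ k, ∀ S, MinAssignF m n l x S → S.image Prod.fst = I l ∧ S.image Prod.snd = J l) ∧
    ∀ S, MinAssignF m n (k + 1) x S → S.image Prod.fst = A ∧ S.image Prod.snd = B ∧ p ∈ S

lemma FlagStep.swap {m n : ℕ} {I : ℕ → Finset (Fin m)} {J : ℕ → Finset (Fin n)} {k : ℕ}
    {A : Finset (Fin m)} {B : Finset (Fin n)} {p : Fin m × Fin n} {x : Fin m × Fin n → ℝ}
    (h : FlagStep I J k A B p x) : FlagStep J I k B A p.swap (x ∘ Prod.swap) := by
  refine ⟨fun l hl S hS => ?_, fun S hS => ?_⟩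
  · have := h.1 l hl _ hS.swap
    rw [image_fst_image_swap, image_snd_image_swap] at this
    exact this.symm
  · have := h.2 _ hS.swap
    rw [image_fst_image_swap, image_snd_image_swap] at this
    refine ⟨this.2.1, this.1, ?_⟩
    obtain ⟨q, hq, rfl⟩ := Finset.mem_image.1 this.2.2
    simpa using hq

lemma FlagStep.le_of_row {m n : ℕ} {I : ℕ → Finset (Fin m)} {J : ℕ → Finset (Fin n)} {k : ℕ}
    {B : Finset (Fin n)} {i i' : Fin m} {j : Fin n} {x : Fin m × Fin n → ℝ} (hm : k + 1 ≤ m)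
    (hn : k + 1 ≤ n) (hii' : i ≠ i') (hi' : i' ∉ I k)
    (h : FlagStep I J k (insert i (I k)) B (i, j) x) : x (i, j) ≤ x (i', j) := by
  obtain ⟨M, hM⟩ := exists_minAssignF hm hn x
  obtain ⟨h1, h2, h3⟩ := h.2 M hM
  have hi'M : i' ∉ M.image Prod.fst := by
    rw [h1, Finset.mem_insert]
    exact fun h => h.elim (fun h => hii' h.symm) hi'
  have := hM.2 _ (hM.1.replace_row h3 hi'M)
  rw [sum_insert_erase h3 fun h => hi'M (Finset.mem_image_of_mem Prod.fst h)] at this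
  linarith

lemma FlagStep.exchange_row {m n : ℕ} {I : ℕ → Finset (Fin m)} {J : ℕ → Finset (Fin n)} {k : ℕ}
    {B : Finset (Fin n)} {i i' : Fin m} {j : Fin n} {x x' : Fin m × Fin n → ℝ} (hm : k + 1 ≤ m)
    (hn : k + 1 ≤ n) (hx : GenericMatrix x) (hx' : GenericMatrix x') (hii' : i ≠ i')
    (hi : i ∉ I k) (hi' : i' ∉ I k)
    (hxx' : ∀ p, p ≠ (i, j) → p ≠ (i', j) → x' p = x p) (hq : x' (i', j) = x (i, j))
    (hp : x (i, j) ≤ x' (i, j)) (h : FlagStep I J k (insert i (I k)) B (i, j) x) :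
    FlagStep I J k (insert i' (I k)) B (i', j) x' := by
  have hsum : ∀ S : Finset (Fin m × Fin n), (i, j) ∉ S → (i', j) ∉ S →
      ∑ p ∈ S, x' p = ∑ p ∈ S, x p := fun S h1 h2 => Finset.sum_congr rfl fun p hp =>
    hxx' p (fun h => h1 (h ▸ hp)) fun h => h2 (h ▸ hp)
  have hrow : ∀ {a : Fin m} {b : Fin n} {S : Finset (Fin m × Fin n)},
      a ∉ S.image Prod.fst → (a, b) ∉ S :=
    fun ha h => ha (Finset.mem_image_of_mem Prod.fst h)
  have havoid : ∀ l ≤ k, ∀ S, MinAssignF m n l x S →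
      i ∉ S.image Prod.fst ∧ i' ∉ S.image Prod.fst := by
    intro l hl S hS
    obtain ⟨T, hT⟩ := exists_minAssignF (by omega : k ≤ m) (by omega : k ≤ n) x
    have h1 := hS.image_fst_subset_of_le hl (by omega) (by omega) hx hT
    rw [(h.1 k le_rfl T hT).1] at h1
    exact ⟨fun h => hi (h1 h), fun h => hi' (h1 h)⟩
  have hlow : ∀ l, l ≤ k + 1 → ∀ S', MinAssignF m n l x' S' →
      ¬ (i ∈ S'.image Prod.fst ∧ i' ∈ S'.image Prod.fst) →
      ∃ T, IsAssignF m n l T ∧ ∑ p ∈ T, x p ≤ ∑ p ∈ S', x' p := by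
    intro l hl S' hS' hone
    by_cases hqS : (i', j) ∈ S'
    · have hiS : i ∉ S'.image Prod.fst :=
        fun h => hone ⟨h, Finset.mem_image_of_mem Prod.fst hqS⟩
      refine ⟨_, hS'.1.replace_row hqS hiS, le_of_eq ?_⟩
      rw [← Finset.add_sum_erase S' x' hqS, hq, hsum _ (fun h => hrow hiS
        (Finset.mem_of_mem_erase h)) (Finset.notMem_erase _ _),
        Finset.sum_insert fun h => hrow hiS (Finset.mem_of_mem_erase h)]
    · refine ⟨S', hS'.1, Finset.sum_le_sum fun p hpS => ?_⟩
      by_cases h1 : p = (i, j)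
      · rw [h1]; exact hp
      · exact (hxx' p h1 fun h => hqS (h ▸ hpS)).ge
  have hone : ∀ l, (∀ l' < l, ∀ S', MinAssignF m n l' x' S' → MinAssignF m n l' x S') →
      l ≤ k + 1 → ∀ S', MinAssignF m n l x' S' →
      ¬ (i ∈ S'.image Prod.fst ∧ i' ∈ S'.image Prod.fst) := by
    rintro l ih hl S' hS' ⟨h1, h2⟩
    obtain _ | l := l
    · have := Finset.card_eq_zero.1 hS'.1.1
      simp [this] at h1
    · obtain ⟨R, hR⟩ := exists_minAssignF (by omega : l ≤ m) (by omega : l ≤ n) x'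
      obtain ⟨h3, h4⟩ := havoid l (by omega) R (ih l (by omega) R hR)
      have h5 : insert i (insert i' (R.image Prod.fst)) ⊆ S'.image Prod.fst :=
        Finset.insert_subset h1 (Finset.insert_subset h2 (hR.image_fst_subset hx' hS'))
      have h6 := Finset.card_le_card h5
      rw [Finset.card_insert_of_notMem (by simp only [Finset.mem_insert, not_or]; exact ⟨hii', h3⟩),
        Finset.card_insert_of_notMem h4, hR.1.card_image_fst, hS'.1.card_image_fst] at h6
      omega
  have hmin : ∀ l, l ≤ k → ∀ S', MinAssignF m n l x' S' → MinAssignF m n l x S' := by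
    intro l
    induction l using Nat.strong_induction_on with
    | _ l ih =>
      intro hl S' hS'
      have h1 := hone l (fun l' hl' => ih l' hl' (by omega)) (by omega) S' hS'
      obtain ⟨T, hT, hTS⟩ := hlow l (by omega) S' hS' h1
      obtain ⟨S, hS⟩ := exists_minAssignF (by omega : l ≤ m) (by omega : l ≤ n) x
      obtain ⟨h2, h3⟩ := havoid l hl S hS
      have h4 : ∑ p ∈ S, x' p ≤ ∑ p ∈ S', x' p := by
        rw [hsum S (hrow h2) (hrow h3)]
        exact (hS.2 T hT).trans hTS
      have h5 : MinAssignF m n l x' S := ⟨hS.1, fun U hU => h4.trans (hS'.2 U hU)⟩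
      rwa [hS'.eq hx' h5]
  refine ⟨fun l hl S' hS' => h.1 l hl S' (hmin l hl S' hS'), fun S' hS' => ?_⟩
  obtain ⟨M, hM⟩ := exists_minAssignF hm hn x
  obtain ⟨hMI, hMB, hpM⟩ := h.2 M hM
  have hi'M : i' ∉ M.image Prod.fst := by
    rw [hMI, Finset.mem_insert]
    exact fun h => h.elim (fun h => hii' h.symm) hi'
  obtain ⟨T, hT, hTS⟩ := hlow (k + 1) le_rfl S' hS'
    (hone (k + 1) (fun l' hl' => hmin l' (by omega)) le_rfl S' hS')
  have h1 : ∑ p ∈ insert (i', j) (M.erase (i, j)), x' p = ∑ p ∈ M, x p := by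
    rw [Finset.sum_insert fun h => hrow hi'M (Finset.mem_of_mem_erase h), hq,
      ← Finset.add_sum_erase M x hpM, hsum _ (Finset.notMem_erase _ _)
        fun h => hrow hi'M (Finset.mem_of_mem_erase h)]
  have h2 : MinAssignF m n (k + 1) x' (insert (i', j) (M.erase (i, j))) := by
    refine ⟨hM.1.replace_row hpM hi'M, fun U hU => ?_⟩
    rw [h1]
    exact ((hM.2 T hT).trans hTS).trans (hS'.2 U hU)
  rw [hS'.eq hx' h2, hM.1.image_fst_replace_row hpM, image_snd_replace_row hpM, hMI, hMB,
    Finset.erase_insert hi]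
  exact ⟨rfl, rfl, Finset.mem_insert_self _ _⟩

lemma FlagStep.le_of_col {m n : ℕ} {I : ℕ → Finset (Fin m)} {J : ℕ → Finset (Fin n)} {k : ℕ}
    {A : Finset (Fin m)} {i : Fin m} {j j' : Fin n} {x : Fin m × Fin n → ℝ} (hm : k + 1 ≤ m)
    (hn : k + 1 ≤ n) (hjj' : j ≠ j') (hj' : j' ∉ J k)
    (h : FlagStep I J k A (insert j (J k)) (i, j) x) : x (i, j) ≤ x (i, j') :=
  h.swap.le_of_row hn hm hjj' hj'

lemma FlagStep.exchange_col {m n : ℕ} {I : ℕ → Finset (Fin m)} {J : ℕ → Finset (Fin n)} {k : ℕ}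
    {A : Finset (Fin m)} {i : Fin m} {j j' : Fin n} {x x' : Fin m × Fin n → ℝ} (hm : k + 1 ≤ m)
    (hn : k + 1 ≤ n) (hx : GenericMatrix x) (hx' : GenericMatrix x') (hjj' : j ≠ j')
    (hj : j ∉ J k) (hj' : j' ∉ J k)
    (hxx' : ∀ p, p ≠ (i, j) → p ≠ (i, j') → x' p = x p) (hq : x' (i, j') = x (i, j))
    (hp : x (i, j) ≤ x' (i, j)) (h : FlagStep I J k A (insert j (J k)) (i, j) x) :
    FlagStep I J k A (insert j' (J k)) (i, j') x' := by
  have := h.swap.exchange_row (x' := x' ∘ Prod.swap) hn hm hx.swap hx'.swap hjj' hj hj'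
    (fun p h1 h2 => hxx' p.swap (fun h => h1 (by rw [← Prod.swap_swap p, h]; rfl))
      fun h => h2 (by rw [← Prod.swap_swap p, h]; rfl)) hq hp
  exact this.swap

/-- The density of the exponential distribution with rate `a`. -/
noncomputable def expDensity (a t : ℝ) : ℝ := if 0 ≤ t then a * Real.exp (-(a * t)) else 0

lemma expDensity_nonneg {a : ℝ} (ha : 0 < a) (t : ℝ) : 0 ≤ expDensity a t := by
  unfold expDensity
  split_ifs <;> positivity

lemma measurable_expDensity (a : ℝ) : Measurable (expDensity a) := by
  unfold expDensity
  exact Measurable.ite measurableSet_Ici (by fun_prop) measurable_const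

lemma lintegral_expDensity {a : ℝ} (ha : 0 < a) : ∫⁻ t, ENNReal.ofReal (expDensity a t) = 1 := by
  rw [← ProbabilityTheory.lintegral_exponentialPDF_eq_one ha]
  exact lintegral_congr fun t => (ProbabilityTheory.exponentialPDF_eq a t).symm

lemma integrable_expDensity {a : ℝ} (ha : 0 < a) : Integrable (expDensity a) := by
  refine ⟨(measurable_expDensity a).aestronglyMeasurable, ?_⟩
  rw [hasFiniteIntegral_iff_ofReal (Filter.Eventually.of_forall (expDensity_nonneg ha)),
    lintegral_expDensity ha]
  exact ENNReal.one_lt_top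

lemma integral_expDensity {a : ℝ} (ha : 0 < a) : ∫ t, expDensity a t = 1 := by
  rw [integral_eq_lintegral_of_nonneg_ae (Filter.Eventually.of_forall (expDensity_nonneg ha))
    (measurable_expDensity a).aestronglyMeasurable, lintegral_expDensity ha, ENNReal.toReal_one]

section ExpProduct

variable {α : Type*}

section ExchangeMap

variable [DecidableEq α]

/-- The linear map `x ↦ x + (x q - x p) • (ρ e_p - e_q)`. It moves the value at `p` to `q` and
rescales the increment from the value at `p` to the value at `q` by `ρ`. -/
noncomputable def exchangeMap (p q : α) (ρ : ℝ) : (α → ℝ) →ₗ[ℝ] (α → ℝ) :=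
  LinearMap.transvection
    ((LinearMap.proj q : (α → ℝ) →ₗ[ℝ] ℝ) - (LinearMap.proj p : (α → ℝ) →ₗ[ℝ] ℝ))
    (ρ • Pi.single p 1 - Pi.single q 1)

lemma exchangeMap_apply (p q : α) (ρ : ℝ) (x : α → ℝ) (s : α) :
    exchangeMap p q ρ x s = x s + (x q - x p) *
      (ρ * (if s = p then 1 else 0) - if s = q then 1 else 0) := by
  simp [exchangeMap, LinearMap.transvection, Pi.single_apply]

lemma exchangeMap_apply_left {p q : α} (hpq : p ≠ q) (ρ : ℝ) (x : α → ℝ) :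
    exchangeMap p q ρ x p = x p + ρ * (x q - x p) := by
  rw [exchangeMap_apply, if_pos rfl, if_neg hpq]
  ring

lemma exchangeMap_apply_right {p q : α} (hpq : p ≠ q) (ρ : ℝ) (x : α → ℝ) :
    exchangeMap p q ρ x q = x p := by
  rw [exchangeMap_apply, if_pos rfl, if_neg hpq.symm]
  ring

lemma exchangeMap_apply_of_ne {p q s : α} (hp : s ≠ p) (hq : s ≠ q) (ρ : ℝ) (x : α → ℝ) :
    exchangeMap p q ρ x s = x s := by
  rw [exchangeMap_apply, if_neg hp, if_neg hq]
  ring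

end ExchangeMap

variable [Fintype α]

/-- The joint density of independent exponential variables with rates `a`. -/
noncomputable def expProductDensity (a x : α → ℝ) : ℝ := ∏ p, expDensity (a p) (x p)

lemma measurable_expProductDensity (a : α → ℝ) : Measurable (expProductDensity a) :=
  Finset.measurable_prod _ fun p _ => (measurable_expDensity (a p)).comp (measurable_pi_apply p)

lemma lintegral_expProductDensity {a : α → ℝ} (ha : ∀ p, 0 < a p) :
    ∫⁻ x, ENNReal.ofReal (expProductDensity a x) = 1 := by
  rw [← ofReal_integral_eq_lintegral_ofReal]
  · unfold expProductDensity
    rw [integral_fintype_prod_volume_eq_prod fun p => expDensity (a p)]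
    simp [integral_expDensity (ha _)]
  · exact Integrable.fintype_prod fun p => integrable_expDensity (ha p)
  · exact Filter.Eventually.of_forall fun x =>
      Finset.prod_nonneg fun p _ => expDensity_nonneg (ha p) _

variable [DecidableEq α]

lemma det_exchangeMap {p q : α} (hpq : p ≠ q) (ρ : ℝ) :
    LinearMap.det (exchangeMap p q ρ) = -ρ := by
  rw [exchangeMap, LinearMap.transvection.det]
  simp [hpq, hpq.symm]
  ring

lemma expProductDensity_exchangeMap {a : α → ℝ} (ha : ∀ p, 0 < a p) {p q : α} (hpq : p ≠ q)
    {x : α → ℝ} (hx : x p ≤ x q) :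
    expProductDensity a (exchangeMap p q (a q / a p) x) = expProductDensity a x := by
  have hq : q ∈ Finset.univ.erase p := Finset.mem_erase.2 ⟨hpq.symm, Finset.mem_univ q⟩
  unfold expProductDensity
  rw [← Finset.mul_prod_erase _ _ (Finset.mem_univ p), ← Finset.mul_prod_erase _ _ hq,
    ← Finset.mul_prod_erase _ _ (Finset.mem_univ p), ← Finset.mul_prod_erase _ _ hq,
    ← mul_assoc, ← mul_assoc, exchangeMap_apply_left hpq, exchangeMap_apply_right hpq]
  congr 1
  · have hap := ha p
    have haq := ha q
    unfold expDensity
    by_cases h0 : 0 ≤ x p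
    · have h1 : 0 ≤ x q := h0.trans hx
      have h2 : 0 ≤ x p + a q / a p * (x q - x p) :=
        add_nonneg h0 (mul_nonneg (div_pos haq hap).le (sub_nonneg.2 hx))
      have hexp : ∀ u v : ℝ, a p * Real.exp u * (a q * Real.exp v) =
          a p * a q * Real.exp (u + v) := fun u v => by rw [Real.exp_add]; ring
      rw [if_pos h0, if_pos h1, if_pos h2, if_pos h0, hexp, hexp]
      congr 2
      field_simp
      ring
    · rw [if_neg h0, if_neg h0, mul_zero, zero_mul]
  · refine Finset.prod_congr rfl fun s hs => ?_
    rw [exchangeMap_apply_of_ne (Finset.mem_erase.1 (Finset.mem_erase.1 hs).2).1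
      (Finset.mem_erase.1 hs).1]

lemma quasiMeasurePreserving_exchangeMap {p q : α} (hpq : p ≠ q) {ρ : ℝ} (hρ : ρ ≠ 0) :
    Measure.QuasiMeasurePreserving (exchangeMap p q ρ) volume volume := by
  refine ⟨(exchangeMap p q ρ).continuous_of_finiteDimensional.measurable, ?_⟩
  rw [Measure.map_linearMap_addHaar_eq_smul_addHaar _
    (by rw [det_exchangeMap hpq]; exact neg_ne_zero.2 hρ)]
  exact Measure.smul_absolutelyContinuous

lemma withDensity_exchangeMap {a : α → ℝ} (ha : ∀ p, 0 < a p) {p q : α} (hpq : p ≠ q)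
    {F F' : Set (α → ℝ)} (hF : MeasurableSet F) (hF' : MeasurableSet F')
    (hle : ∀ x ∈ F, x p ≤ x q)
    (hFF' : ∀ᵐ x : α → ℝ, exchangeMap p q (a q / a p) x ∈ F' ↔ x ∈ F) :
    (volume.withDensity fun x => ENNReal.ofReal (expProductDensity a x)) F * ENNReal.ofReal (a q) =
    (volume.withDensity fun x => ENNReal.ofReal (expProductDensity a x)) F' *
      ENNReal.ofReal (a p) := by
  have hap := ha p
  have haq := ha q
  have hρ : 0 < a q / a p := div_pos haq hap
  have hmeas : Measurable (exchangeMap p q (a q / a p)) :=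
    (exchangeMap p q (a q / a p)).continuous_of_finiteDimensional.measurable
  have hg : Measurable fun x => ENNReal.ofReal (expProductDensity a x) :=
    (measurable_expProductDensity a).ennreal_ofReal
  rw [withDensity_apply _ hF, withDensity_apply _ hF', ← lintegral_indicator hF,
    ← lintegral_indicator hF']
  have hmap := lintegral_map (μ := volume) (hg.indicator hF') hmeas
  rw [Measure.map_linearMap_addHaar_eq_smul_addHaar _
    (by rw [det_exchangeMap hpq]; exact neg_ne_zero.2 hρ.ne'), lintegral_smul_measure] at hmap
  have hcongr : ∫⁻ x, F'.indicator (fun x => ENNReal.ofReal (expProductDensity a x))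
      (exchangeMap p q (a q / a p) x) =
      ∫⁻ x, F.indicator (fun x => ENNReal.ofReal (expProductDensity a x)) x := by
    refine lintegral_congr_ae ?_
    filter_upwards [hFF'] with x hx
    by_cases hxF : x ∈ F
    · rw [Set.indicator_of_mem hxF, Set.indicator_of_mem (hx.2 hxF),
        expProductDensity_exchangeMap ha hpq (hle x hxF)]
    · rw [Set.indicator_of_notMem hxF, Set.indicator_of_notMem fun h => hxF (hx.1 h)]
  rw [← hcongr, ← hmap, det_exchangeMap hpq, smul_eq_mul, mul_right_comm, mul_comm,
    ← ENNReal.ofReal_mul (abs_nonneg _)]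
  congr 2
  rw [inv_neg, abs_neg, abs_of_pos (inv_pos.2 hρ)]
  field_simp

end ExpProduct

lemma ae_genericMatrix (m n : ℕ) : ∀ᵐ x : Fin m × Fin n → ℝ, GenericMatrix x := by
  unfold GenericMatrix
  rw [ae_all_iff]
  intro S
  rw [ae_all_iff]
  intro T
  by_cases hST : S = T
  · exact Filter.Eventually.of_forall fun x _ => hST
  let φ : (Fin m × Fin n → ℝ) →ₗ[ℝ] ℝ :=
    ∑ p ∈ S, LinearMap.proj p - ∑ p ∈ T, LinearMap.proj p
  have hφ : ∀ x, φ x = ∑ p ∈ S, x p - ∑ p ∈ T, x p := fun x => by simp [φ]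
  have hne : LinearMap.ker φ ≠ ⊤ := by
    intro h
    refine hST (Finset.ext fun p => ?_)
    have h1 : φ (Pi.single p 1) = 0 := by
      rw [← LinearMap.mem_ker, h]
      trivial
    rw [hφ] at h1
    by_cases hS : p ∈ S <;> by_cases hT : p ∈ T <;> simp_all
  have h0 := Measure.addHaar_submodule volume _ hne
  rw [ae_iff]
  refine measure_mono_null (fun x hx => ?_) h0
  simp only [Set.mem_ofPred_eq, Classical.not_imp] at hx
  rw [SetLike.mem_coe, LinearMap.mem_ker, hφ, sub_eq_zero]
  exact hx.1

lemma rankOneMeasure_eq (m n : ℕ) (r : Fin m → ℝ) (c : Fin n → ℝ) :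
    rankOneMeasure m n r c = volume.withDensity fun x =>
      ENNReal.ofReal (expProductDensity (fun p : Fin m × Fin n => r p.1 * c p.2) x) := rfl

lemma isProbabilityMeasure_rankOneMeasure {m n : ℕ} {r : Fin m → ℝ} {c : Fin n → ℝ}
    (hr : ∀ i, 0 < r i) (hc : ∀ j, 0 < c j) : IsProbabilityMeasure (rankOneMeasure m n r c) := by
  constructor
  rw [rankOneMeasure_eq, withDensity_apply _ MeasurableSet.univ, Measure.restrict_univ]
  exact lintegral_expProductDensity fun p => mul_pos (hr _) (hc _)

lemma ae_rankOneMeasure_genericMatrix {m n : ℕ} (r : Fin m → ℝ) (c : Fin n → ℝ) :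
    ∀ᵐ x ∂rankOneMeasure m n r c, GenericMatrix x :=
  (withDensity_absolutelyContinuous _ _).ae_le (ae_genericMatrix m n)

lemma measurable_minAssignF (m n k : ℕ) (S : Finset (Fin m × Fin n)) :
    Measurable fun x => MinAssignF m n k x S := by
  refine Measurable.and measurable_const (Measurable.forall fun T => ?_)
  refine Measurable.imp measurable_const ?_
  rw [← measurableSet_setOfPred]
  exact measurableSet_le (by fun_prop) (by fun_prop)

/-- The minimum `l`-assignments for `l ≤ k` span the rows `I l` and columns `J l`. -/
def FlagUpTo {m n : ℕ} (I : ℕ → Finset (Fin m)) (J : ℕ → Finset (Fin n)) (k : ℕ)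
    (x : Fin m × Fin n → ℝ) : Prop :=
  ∀ l ≤ k, ∀ S, MinAssignF m n l x S → S.image Prod.fst = I l ∧ S.image Prod.snd = J l

/-- The minimum `l`-assignments for `l ≤ k` span the rows `I l` and columns `J l`, and the minimum
`(k + 1)`-assignment spans the rows `A` and columns `B`. -/
def FlagExtends {m n : ℕ} (I : ℕ → Finset (Fin m)) (J : ℕ → Finset (Fin n)) (k : ℕ)
    (A : Finset (Fin m)) (B : Finset (Fin n)) (x : Fin m × Fin n → ℝ) : Prop :=
  FlagUpTo I J k x ∧ ∀ S, MinAssignF m n (k + 1) x S → S.image Prod.fst = A ∧ S.image Prod.snd = B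

section Measurability

variable {m n : ℕ} (I : ℕ → Finset (Fin m)) (J : ℕ → Finset (Fin n)) (k : ℕ)
  (A : Finset (Fin m)) (B : Finset (Fin n))

lemma measurableSet_flagUpTo : MeasurableSet {x | FlagUpTo I J k x} := by
  rw [measurableSet_setOfPred]
  exact Measurable.forall fun l => measurable_const.imp <| Measurable.forall fun S =>
    (measurable_minAssignF m n l S).imp measurable_const

lemma measurableSet_flagExtends : MeasurableSet {x | FlagExtends I J k A B x} := by
  rw [measurableSet_setOfPred]
  exact (measurableSet_setOfPred.1 (measurableSet_flagUpTo I J k)).and <| Measurable.forall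
    fun S => (measurable_minAssignF m n (k + 1) S).imp measurable_const

lemma measurableSet_flagStep (p : Fin m × Fin n) :
    MeasurableSet {x | FlagStep I J k A B p x} := by
  rw [measurableSet_setOfPred]
  exact (measurableSet_setOfPred.1 (measurableSet_flagUpTo I J k)).and <| Measurable.forall
    fun S => (measurable_minAssignF m n (k + 1) S).imp measurable_const

end Measurability

lemma measureReal_eq_sum {Ω T : Type*} [MeasurableSpace Ω] {μ : Measure Ω} [IsFiniteMeasure μ]
    (s : Finset T) {B : Set Ω} {E : T → Set Ω} (hE : ∀ t ∈ s, MeasurableSet (E t))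
    (hB : ∀ᵐ x ∂μ, x ∈ B ↔ ∃ t ∈ s, x ∈ E t)
    (hdisj : ∀ᵐ x ∂μ, ∀ t ∈ s, ∀ t' ∈ s, x ∈ E t → x ∈ E t' → t = t') :
    μ.real B = ∑ t ∈ s, μ.real (E t) := by
  rw [← measureReal_biUnion_finset₀]
  · refine measureReal_congr (Filter.eventuallyEq_set.2 ?_)
    filter_upwards [hB] with x hx
    rw [hx]
    simp
  · intro t ht t' ht' htt'
    refine measure_mono_null ?_ (ae_iff.1 hdisj)
    exact fun x hx h => htt' (h t ht t' ht' hx.1 hx.2)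
  · exact fun t ht => (hE t ht).nullMeasurableSet

lemma flagExtends_iff_exists_flagStep_row {m n : ℕ} {I : ℕ → Finset (Fin m)}
    {J : ℕ → Finset (Fin n)} {k : ℕ} {A : Finset (Fin m)} {B : Finset (Fin n)} {i : Fin m}
    (hm : k + 1 ≤ m) (hn : k + 1 ≤ n) (hi : i ∈ A) {x : Fin m × Fin n → ℝ}
    (hx : GenericMatrix x) : FlagExtends I J k A B x ↔ ∃ j, FlagStep I J k A B (i, j) x := by
  constructor
  · rintro ⟨h1, h2⟩
    obtain ⟨M, hM⟩ := exists_minAssignF hm hn x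
    rw [← (h2 M hM).1] at hi
    obtain ⟨p, hp, rfl⟩ := Finset.mem_image.1 hi
    exact ⟨p.2, h1, fun S hS => ⟨(h2 S hS).1, (h2 S hS).2, hS.eq hx hM ▸ hp⟩⟩
  · rintro ⟨j, h1, h2⟩
    exact ⟨h1, fun S hS => ⟨(h2 S hS).1, (h2 S hS).2.1⟩⟩

lemma flagExtends_iff_exists_flagStep_col {m n : ℕ} {I : ℕ → Finset (Fin m)}
    {J : ℕ → Finset (Fin n)} {k : ℕ} {A : Finset (Fin m)} {B : Finset (Fin n)} {j : Fin n}
    (hm : k + 1 ≤ m) (hn : k + 1 ≤ n) (hj : j ∈ B) {x : Fin m × Fin n → ℝ}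
    (hx : GenericMatrix x) : FlagExtends I J k A B x ↔ ∃ i, FlagStep I J k A B (i, j) x := by
  constructor
  · rintro ⟨h1, h2⟩
    obtain ⟨M, hM⟩ := exists_minAssignF hm hn x
    rw [← (h2 M hM).2] at hj
    obtain ⟨p, hp, rfl⟩ := Finset.mem_image.1 hj
    exact ⟨p.1, h1, fun S hS => ⟨(h2 S hS).1, (h2 S hS).2, hS.eq hx hM ▸ hp⟩⟩
  · rintro ⟨i, h1, h2⟩
    exact ⟨h1, fun S hS => ⟨(h2 S hS).1, (h2 S hS).2.1⟩⟩

lemma FlagUpTo.exists_flagExtends {m n : ℕ} {I : ℕ → Finset (Fin m)} {J : ℕ → Finset (Fin n)}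
    {k : ℕ} (hm : k + 1 ≤ m) (hn : k + 1 ≤ n) {x : Fin m × Fin n → ℝ} (hx : GenericMatrix x)
    (h : FlagUpTo I J k x) :
    ∃ i ∉ I k, ∃ j ∉ J k, FlagExtends I J k (insert i (I k)) (insert j (J k)) x := by
  obtain ⟨M, hM⟩ := exists_minAssignF (by omega : k ≤ m) (by omega : k ≤ n) x
  obtain ⟨N, hN⟩ := exists_minAssignF hm hn x
  obtain ⟨h1, h2⟩ := h k le_rfl M hM
  obtain ⟨i, hi, hiN⟩ := Finset.exists_eq_insert_iff.2 ⟨hM.image_fst_subset hx hN, by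
    rw [hM.1.card_image_fst, hN.1.card_image_fst]⟩
  obtain ⟨j, hj, hjN⟩ := Finset.exists_eq_insert_iff.2 ⟨hM.image_snd_subset hx hN, by
    rw [← image_fst_image_swap, ← image_fst_image_swap, hM.1.swap.card_image_fst,
      hN.1.swap.card_image_fst]⟩
  rw [h1] at hi hiN
  rw [h2] at hj hjN
  exact ⟨i, hi, j, hj, h, fun S hS => by rw [hS.eq hx hN, hiN, hjN]; exact ⟨rfl, rfl⟩⟩

section StepProbability

variable {m n : ℕ} {r : Fin m → ℝ} {c : Fin n → ℝ} (I : ℕ → Finset (Fin m))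
  (J : ℕ → Finset (Fin n)) {k : ℕ}

lemma measureReal_flagStep_row (hr : ∀ i, 0 < r i) (hc : ∀ j, 0 < c j) (hm : k + 1 ≤ m)
    (hn : k + 1 ≤ n) {i i' : Fin m} (hii' : i ≠ i') (hi : i ∉ I k) (hi' : i' ∉ I k)
    (B : Finset (Fin n)) (j : Fin n) :
    (rankOneMeasure m n r c).real {x | FlagStep I J k (insert i (I k)) B (i, j) x} * r i' =
    (rankOneMeasure m n r c).real {x | FlagStep I J k (insert i' (I k)) B (i', j) x} * r i := by
  have ha : ∀ p : Fin m × Fin n, 0 < r p.1 * c p.2 := fun p => mul_pos (hr _) (hc _)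
  have hpq : (i, j) ≠ (i', j) := fun h => hii' (congrArg Prod.fst h)
  have hρ : 0 < (r i' * c j) / (r i * c j) := div_pos (ha (i', j)) (ha (i, j))
  have key := withDensity_exchangeMap ha hpq
    (measurableSet_flagStep I J k (insert i (I k)) B (i, j))
    (measurableSet_flagStep I J k (insert i' (I k)) B (i', j))
    (fun x hx => FlagStep.le_of_row hm hn hii' hi' hx) (by
      filter_upwards [ae_genericMatrix m n,
        (quasiMeasurePreserving_exchangeMap hpq hρ.ne').ae (ae_genericMatrix m n)] with x hx hx'
      constructor
      · intro h
        have h1 := FlagStep.le_of_row hm hn hii'.symm hi h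
        rw [exchangeMap_apply_left hpq, exchangeMap_apply_right hpq] at h1
        have h2 : x (i, j) ≤ x (i', j) := by
          by_contra! hlt
          have := mul_neg_of_pos_of_neg hρ (sub_neg.2 hlt)
          linarith
        refine FlagStep.exchange_row hm hn hx' hx hii'.symm hi' hi (fun p h3 h4 => ?_) ?_ ?_ h
        · rw [exchangeMap_apply_of_ne h4 h3]
        · rw [exchangeMap_apply_right hpq]
        · rwa [exchangeMap_apply_right hpq]
      · intro h
        have h1 := FlagStep.le_of_row hm hn hii' hi' h
        refine FlagStep.exchange_row hm hn hx hx' hii' hi hi' (fun p h3 h4 => ?_) ?_ ?_ h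
        · rw [exchangeMap_apply_of_ne h3 h4]
        · rw [exchangeMap_apply_right hpq]
        · rw [exchangeMap_apply_left hpq]
          exact le_add_of_nonneg_right (mul_nonneg hρ.le (sub_nonneg.2 h1)))
  rw [← rankOneMeasure_eq] at key
  have key' := congrArg ENNReal.toReal key
  rw [ENNReal.toReal_mul, ENNReal.toReal_mul, ENNReal.toReal_ofReal (ha _).le,
    ENNReal.toReal_ofReal (ha _).le] at key'
  refine mul_right_cancel₀ (hc j).ne' ?_
  rw [mul_assoc, mul_assoc]
  exact key'

lemma measureReal_flagStep_col (hr : ∀ i, 0 < r i) (hc : ∀ j, 0 < c j) (hm : k + 1 ≤ m)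
    (hn : k + 1 ≤ n) {j j' : Fin n} (hjj' : j ≠ j') (hj : j ∉ J k) (hj' : j' ∉ J k)
    (A : Finset (Fin m)) (i : Fin m) :
    (rankOneMeasure m n r c).real {x | FlagStep I J k A (insert j (J k)) (i, j) x} * c j' =
    (rankOneMeasure m n r c).real {x | FlagStep I J k A (insert j' (J k)) (i, j') x} * c j := by
  have ha : ∀ p : Fin m × Fin n, 0 < r p.1 * c p.2 := fun p => mul_pos (hr _) (hc _)
  have hpq : (i, j) ≠ (i, j') := fun h => hjj' (congrArg Prod.snd h)
  have hρ : 0 < (r i * c j') / (r i * c j) := div_pos (ha (i, j')) (ha (i, j))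
  have key := withDensity_exchangeMap ha hpq
    (measurableSet_flagStep I J k A (insert j (J k)) (i, j))
    (measurableSet_flagStep I J k A (insert j' (J k)) (i, j'))
    (fun x hx => FlagStep.le_of_col hm hn hjj' hj' hx) (by
      filter_upwards [ae_genericMatrix m n,
        (quasiMeasurePreserving_exchangeMap hpq hρ.ne').ae (ae_genericMatrix m n)] with x hx hx'
      constructor
      · intro h
        have h1 := FlagStep.le_of_col hm hn hjj'.symm hj h
        rw [exchangeMap_apply_left hpq, exchangeMap_apply_right hpq] at h1
        have h2 : x (i, j) ≤ x (i, j') := by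
          by_contra! hlt
          have := mul_neg_of_pos_of_neg hρ (sub_neg.2 hlt)
          linarith
        refine FlagStep.exchange_col hm hn hx' hx hjj'.symm hj' hj (fun p h3 h4 => ?_) ?_ ?_ h
        · rw [exchangeMap_apply_of_ne h4 h3]
        · rw [exchangeMap_apply_right hpq]
        · rwa [exchangeMap_apply_right hpq]
      · intro h
        have h1 := FlagStep.le_of_col hm hn hjj' hj' h
        refine FlagStep.exchange_col hm hn hx hx' hjj' hj hj' (fun p h3 h4 => ?_) ?_ ?_ h
        · rw [exchangeMap_apply_of_ne h3 h4]
        · rw [exchangeMap_apply_right hpq]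
        · rw [exchangeMap_apply_left hpq]
          exact le_add_of_nonneg_right (mul_nonneg hρ.le (sub_nonneg.2 h1)))
  rw [← rankOneMeasure_eq] at key
  have key' := congrArg ENNReal.toReal key
  rw [ENNReal.toReal_mul, ENNReal.toReal_mul, ENNReal.toReal_ofReal (ha _).le,
    ENNReal.toReal_ofReal (ha _).le] at key'
  refine mul_right_cancel₀ (hr i).ne' ?_
  rw [mul_assoc, mul_assoc, mul_comm (c j'), mul_comm (c j)]
  exact key'

lemma measureReal_flagExtends_row (hr : ∀ i, 0 < r i) (hc : ∀ j, 0 < c j) (hm : k + 1 ≤ m)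
    (hn : k + 1 ≤ n) {i i' : Fin m} (hi : i ∉ I k) (hi' : i' ∉ I k) (B : Finset (Fin n)) :
    (rankOneMeasure m n r c).real {x | FlagExtends I J k (insert i (I k)) B x} * r i' =
    (rankOneMeasure m n r c).real {x | FlagExtends I J k (insert i' (I k)) B x} * r i := by
  have := isProbabilityMeasure_rankOneMeasure hr hc
  by_cases hii' : i = i'
  · rw [hii']
  have hsum : ∀ i, (rankOneMeasure m n r c).real {x | FlagExtends I J k (insert i (I k)) B x} =
      ∑ j, (rankOneMeasure m n r c).real {x | FlagStep I J k (insert i (I k)) B (i, j) x} := by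
    intro i
    refine measureReal_eq_sum _ (fun j _ => measurableSet_flagStep _ _ _ _ _ _) ?_ ?_
    · filter_upwards [ae_rankOneMeasure_genericMatrix r c] with x hx
      simpa using flagExtends_iff_exists_flagStep_row hm hn (Finset.mem_insert_self _ _) hx
    · refine Filter.Eventually.of_forall fun x j _ j' _ h h' => ?_
      obtain ⟨M, hM⟩ := exists_minAssignF hm hn x
      exact congrArg Prod.snd (hM.1.eq_of_fst (h.2 M hM).2.2 (h'.2 M hM).2.2 rfl)
  rw [hsum, hsum, Finset.sum_mul, Finset.sum_mul]
  exact Finset.sum_congr rfl fun j _ => measureReal_flagStep_row I J hr hc hm hn hii' hi hi' B j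

lemma measureReal_flagExtends_col (hr : ∀ i, 0 < r i) (hc : ∀ j, 0 < c j) (hm : k + 1 ≤ m)
    (hn : k + 1 ≤ n) {j j' : Fin n} (hj : j ∉ J k) (hj' : j' ∉ J k) (A : Finset (Fin m)) :
    (rankOneMeasure m n r c).real {x | FlagExtends I J k A (insert j (J k)) x} * c j' =
    (rankOneMeasure m n r c).real {x | FlagExtends I J k A (insert j' (J k)) x} * c j := by
  have := isProbabilityMeasure_rankOneMeasure hr hc
  by_cases hjj' : j = j'
  · rw [hjj']
  have hsum : ∀ j, (rankOneMeasure m n r c).real {x | FlagExtends I J k A (insert j (J k)) x} =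
      ∑ i, (rankOneMeasure m n r c).real {x | FlagStep I J k A (insert j (J k)) (i, j) x} := by
    intro j
    refine measureReal_eq_sum _ (fun i _ => measurableSet_flagStep _ _ _ _ _ _) ?_ ?_
    · filter_upwards [ae_rankOneMeasure_genericMatrix r c] with x hx
      simpa using flagExtends_iff_exists_flagStep_col hm hn (Finset.mem_insert_self _ _) hx
    · refine Filter.Eventually.of_forall fun x i _ i' _ h h' => ?_
      obtain ⟨M, hM⟩ := exists_minAssignF hm hn x
      exact congrArg Prod.fst (hM.1.eq_of_snd (h.2 M hM).2.2 (h'.2 M hM).2.2 rfl)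
  rw [hsum, hsum, Finset.sum_mul, Finset.sum_mul]
  exact Finset.sum_congr rfl fun i _ => measureReal_flagStep_col I J hr hc hm hn hjj' hj hj' A i

lemma measureReal_flagUpTo_eq_sum (hr : ∀ i, 0 < r i) (hc : ∀ j, 0 < c j) (hm : k + 1 ≤ m)
    (hn : k + 1 ≤ n) :
    (rankOneMeasure m n r c).real {x | FlagUpTo I J k x} =
    ∑ i ∈ (I k)ᶜ, ∑ j ∈ (J k)ᶜ, (rankOneMeasure m n r c).real
      {x | FlagExtends I J k (insert i (I k)) (insert j (J k)) x} := by
  have := isProbabilityMeasure_rankOneMeasure hr hc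
  rw [← Finset.sum_product' (I k)ᶜ (J k)ᶜ fun i j => (rankOneMeasure m n r c).real
      {x | FlagExtends I J k (insert i (I k)) (insert j (J k)) x}]
  refine measureReal_eq_sum _ (fun p _ => measurableSet_flagExtends _ _ _ _ _) ?_ ?_
  · filter_upwards [ae_rankOneMeasure_genericMatrix r c] with x hx
    constructor
    · intro h
      obtain ⟨i, hi, j, hj, hij⟩ := FlagUpTo.exists_flagExtends hm hn hx h
      exact ⟨(i, j), by simp [hi, hj], hij⟩
    · rintro ⟨p, -, hp⟩
      exact hp.1
  · refine Filter.Eventually.of_forall fun x p hp q _ h h' => ?_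
    obtain ⟨M, hM⟩ := exists_minAssignF hm hn x
    rw [Finset.mem_product, Finset.mem_compl, Finset.mem_compl] at hp
    have h1 := (h.2 M hM).1.symm.trans (h'.2 M hM).1
    have h2 := (h.2 M hM).2.symm.trans (h'.2 M hM).2
    exact Prod.ext ((Finset.insert_inj hp.1).1 h1) ((Finset.insert_inj hp.2).1 h2)

lemma measureReal_flagExtends (hr : ∀ i, 0 < r i) (hc : ∀ j, 0 < c j) (hm : k + 1 ≤ m)
    (hn : k + 1 ≤ n) {i : Fin m} {j : Fin n} (hi : i ∉ I k) (hj : j ∉ J k) :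
    (rankOneMeasure m n r c).real {x | FlagExtends I J k (insert i (I k)) (insert j (J k)) x} =
    (rankOneMeasure m n r c).real {x | FlagUpTo I J k x} *
      ((r i / ∑ a ∈ (I k)ᶜ, r a) * (c j / ∑ b ∈ (J k)ᶜ, c b)) := by
  have hR : 0 < ∑ a ∈ (I k)ᶜ, r a :=
    Finset.sum_pos (fun a _ => hr a) ⟨i, Finset.mem_compl.2 hi⟩
  have hC : 0 < ∑ b ∈ (J k)ᶜ, c b :=
    Finset.sum_pos (fun b _ => hc b) ⟨j, Finset.mem_compl.2 hj⟩
  have h : (rankOneMeasure m n r c).real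
      {x | FlagExtends I J k (insert i (I k)) (insert j (J k)) x} *
      ((∑ a ∈ (I k)ᶜ, r a) * ∑ b ∈ (J k)ᶜ, c b) =
      (rankOneMeasure m n r c).real {x | FlagUpTo I J k x} * (r i * c j) := by
    rw [measureReal_flagUpTo_eq_sum I J hr hc hm hn, Finset.sum_mul_sum, Finset.mul_sum,
      Finset.sum_mul]
    refine Finset.sum_congr rfl fun a ha => ?_
    rw [Finset.mul_sum, Finset.sum_mul]
    refine Finset.sum_congr rfl fun b hb => ?_
    rw [Finset.mem_compl] at ha hb
    rw [← mul_assoc, measureReal_flagExtends_row I J hr hc hm hn hi ha, mul_right_comm,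
      measureReal_flagExtends_col I J hr hc hm hn hj hb, mul_assoc, mul_comm (c j)]
  rw [div_mul_div_comm, ← mul_div_assoc, eq_div_iff (mul_pos hR hC).ne', h]

end StepProbability

/-- The set of the first `l` terms of the sequence `ι`. -/
def initialSet {m k : ℕ} (ι : Fin k → Fin m) (l : ℕ) : Finset (Fin m) :=
  (Finset.univ.filter fun s : Fin k => (s : ℕ) < l).image ι

lemma initialSet_self {m k : ℕ} (ι : Fin k → Fin m) : initialSet ι k = Finset.univ.image ι := by
  rw [initialSet, Finset.filter_true_of_mem fun s _ => s.2]

lemma initialSet_of_le {m k l : ℕ} (ι : Fin (k + 1) → Fin m) (hl : l ≤ k) :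
    initialSet ι l = initialSet (ι ∘ Fin.castSucc) l := by
  ext a
  simp only [initialSet, Finset.mem_image, Finset.mem_filter, Finset.mem_univ, true_and,
    Function.comp_apply]
  constructor
  · rintro ⟨s, hs, rfl⟩
    exact ⟨⟨s, by omega⟩, hs, rfl⟩
  · rintro ⟨s, hs, rfl⟩
    exact ⟨s.castSucc, hs, rfl⟩

lemma initialSet_succ {m k : ℕ} (ι : Fin (k + 1) → Fin m) :
    initialSet ι (k + 1) = insert (ι (Fin.last k)) (initialSet (ι ∘ Fin.castSucc) k) := by
  rw [initialSet_self, initialSet_self]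
  ext a
  simp [Fin.exists_fin_succ', or_comm, eq_comm]

lemma last_notMem_initialSet {m k : ℕ} {ι : Fin (k + 1) → Fin m} (hι : Function.Injective ι) :
    ι (Fin.last k) ∉ initialSet (ι ∘ Fin.castSucc) k := by
  rw [initialSet_self, Finset.mem_image]
  rintro ⟨s, -, hs⟩
  exact (Fin.castSucc_lt_last s).ne (hι hs)

lemma sum_compl_initialSet {m k : ℕ} (r : Fin m → ℝ) {ι : Fin k → Fin m}
    (hι : Function.Injective ι) :
    ∑ a ∈ (initialSet ι k)ᶜ, r a = ∑ a, r a - ∑ s, r (ι s) := by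
  rw [← Finset.sum_add_sum_compl (initialSet ι k) r, initialSet_self,
    Finset.sum_image fun a _ b _ h => hι h]
  ring

lemma prSeq_succ {m k : ℕ} (r : Fin m → ℝ) {ι : Fin (k + 1) → Fin m}
    (hι : Function.Injective ι) :
    prSeq r ι = prSeq r (ι ∘ Fin.castSucc) *
      (r (ι (Fin.last k)) / ∑ a ∈ (initialSet (ι ∘ Fin.castSucc) k)ᶜ, r a) := by
  have hfil : ∀ s : Fin k, (Finset.univ.filter fun u : Fin (k + 1) => u < s.castSucc) =
      (Finset.univ.filter fun u : Fin k => u < s).map Fin.castSuccEmb := by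
    intro s
    ext u
    cases u using Fin.lastCases <;> simp
    exact (Fin.castSucc_lt_last s).le
  have hlast : (Finset.univ.filter fun u : Fin (k + 1) => u < Fin.last k) =
      Finset.univ.map Fin.castSuccEmb := by
    ext u
    cases u using Fin.lastCases <;> simp [Fin.castSucc_lt_last]
  rw [prSeq, Fin.prod_univ_castSucc, sum_compl_initialSet r (hι.comp (Fin.castSucc_injective k)),
    hlast, Finset.sum_map]
  congr 1
  refine Finset.prod_congr rfl fun s _ => ?_
  rw [hfil, Finset.sum_map]
  rfl

lemma injective_iff_castSucc {m k : ℕ} {ι : Fin (k + 1) → Fin m} :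
    Function.Injective ι ↔ Function.Injective (ι ∘ Fin.castSucc) ∧
      ι (Fin.last k) ∉ initialSet (ι ∘ Fin.castSucc) k := by
  refine ⟨fun h => ⟨h.comp (Fin.castSucc_injective k), last_notMem_initialSet h⟩, ?_⟩
  rintro ⟨h, hlast⟩ a b hab
  rw [initialSet_self] at hlast
  simp only [Finset.mem_image, Finset.mem_univ, true_and, Function.comp_apply, not_exists] at hlast
  cases a using Fin.lastCases with
  | last =>
    cases b using Fin.lastCases with
    | last => rfl
    | cast b => exact absurd hab.symm (hlast b)
  | cast a =>
    cases b using Fin.lastCases with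
    | last => exact absurd hab (hlast a)
    | cast b => exact congrArg Fin.castSucc (h hab)

lemma eq_of_initialSet_eq {m k : ℕ} {ι ι' : Fin k → Fin m} (hι : Function.Injective ι)
    (hι' : Function.Injective ι') (h : ∀ l ≤ k, initialSet ι l = initialSet ι' l) : ι = ι' := by
  induction k with
  | zero => exact Subsingleton.elim _ _
  | succ k ih =>
    have hinit : ι ∘ Fin.castSucc = ι' ∘ Fin.castSucc := by
      refine ih (hι.comp (Fin.castSucc_injective k)) (hι'.comp (Fin.castSucc_injective k)) ?_
      intro l hl
      rw [← initialSet_of_le ι hl, ← initialSet_of_le ι' hl, h l (by omega)]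
    have hlast := h (k + 1) le_rfl
    rw [initialSet_succ, initialSet_succ, ← hinit,
      Finset.insert_inj (last_notMem_initialSet hι)] at hlast
    funext s
    cases s using Fin.lastCases with
    | last => exact hlast
    | cast s => exact congrFun hinit s

lemma flagUpTo_initialSet_succ_iff {m n k : ℕ} (ι : Fin (k + 1) → Fin m)
    (κ : Fin (k + 1) → Fin n) (x : Fin m × Fin n → ℝ) :
    FlagUpTo (initialSet ι) (initialSet κ) (k + 1) x ↔
      FlagExtends (initialSet (ι ∘ Fin.castSucc)) (initialSet (κ ∘ Fin.castSucc)) k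
        (insert (ι (Fin.last k)) (initialSet (ι ∘ Fin.castSucc) k))
        (insert (κ (Fin.last k)) (initialSet (κ ∘ Fin.castSucc) k)) x := by
  rw [← initialSet_succ, ← initialSet_succ]
  constructor
  · refine fun h => ⟨fun l hl S hS => ?_, h (k + 1) le_rfl⟩
    rw [← initialSet_of_le ι hl, ← initialSet_of_le κ hl]
    exact h l (by omega) S hS
  · rintro ⟨h, hlast⟩ l hl S hS
    rcases Nat.le_succ_iff.1 hl with hl | rfl
    · rw [initialSet_of_le ι hl, initialSet_of_le κ hl]
      exact h l hl S hS
    · exact hlast S hS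

lemma flagUpTo_initialSet_zero {m n : ℕ} (ι : Fin 0 → Fin m) (κ : Fin 0 → Fin n)
    (x : Fin m × Fin n → ℝ) : FlagUpTo (initialSet ι) (initialSet κ) 0 x := by
  intro l hl S hS
  obtain rfl := Nat.le_zero.1 hl
  obtain rfl := Finset.card_eq_zero.1 hS.1.1
  simp [initialSet]

lemma measureReal_flagUpTo_initialSet {m n k : ℕ} {r : Fin m → ℝ} {c : Fin n → ℝ}
    (hr : ∀ i, 0 < r i) (hc : ∀ j, 0 < c j) (hm : k ≤ m) (hn : k ≤ n) {ι : Fin k → Fin m}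
    {κ : Fin k → Fin n} (hι : Function.Injective ι) (hκ : Function.Injective κ) :
    (rankOneMeasure m n r c).real {x | FlagUpTo (initialSet ι) (initialSet κ) k x} =
      prSeq r ι * prSeq c κ := by
  have := isProbabilityMeasure_rankOneMeasure hr hc
  induction k with
  | zero =>
    rw [show {x | FlagUpTo (initialSet ι) (initialSet κ) 0 x} = Set.univ from
      Set.eq_univ_of_forall fun x => flagUpTo_initialSet_zero ι κ x]
    simp [prSeq]
  | succ k ih =>
    simp_rw [flagUpTo_initialSet_succ_iff]
    rw [measureReal_flagExtends _ _ hr hc hm hn (last_notMem_initialSet hι)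
      (last_notMem_initialSet hκ), ih (by omega) (by omega) (hι.comp (Fin.castSucc_injective k))
      (hκ.comp (Fin.castSucc_injective k)), prSeq_succ r hι, prSeq_succ c hκ]
    ring

lemma GenericMatrix.exists_flagUpTo_initialSet {m n k : ℕ} (hm : k ≤ m) (hn : k ≤ n)
    {x : Fin m × Fin n → ℝ} (hx : GenericMatrix x) :
    ∃ (ι : Fin k → Fin m) (κ : Fin k → Fin n), Function.Injective ι ∧ Function.Injective κ ∧
      FlagUpTo (initialSet ι) (initialSet κ) k x := by
  induction k with
  | zero =>
    exact ⟨Fin.elim0, Fin.elim0, Function.injective_of_subsingleton _,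
      Function.injective_of_subsingleton _, flagUpTo_initialSet_zero _ _ x⟩
  | succ k ih =>
    obtain ⟨ι, κ, hι, hκ, h⟩ := ih (by omega) (by omega)
    obtain ⟨i, hi, j, hj, hij⟩ := h.exists_flagExtends hm hn hx
    have hsnoc : ∀ {d : ℕ} (τ : Fin k → Fin d) (a : Fin d),
        (Fin.snoc τ a : Fin (k + 1) → Fin d) ∘ Fin.castSucc = τ := fun τ a => by
      funext s
      simp
    refine ⟨Fin.snoc ι i, Fin.snoc κ j, injective_iff_castSucc.2 ?_, injective_iff_castSucc.2 ?_,
      (flagUpTo_initialSet_succ_iff _ _ x).2 ?_⟩ <;> simp only [hsnoc, Fin.snoc_last]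
    exacts [⟨hι, hi⟩, ⟨hκ, hj⟩, hij]

lemma FlagUpTo.initialSet_inj {m n k : ℕ} (hm : k ≤ m) (hn : k ≤ n) {x : Fin m × Fin n → ℝ}
    {ι ι' : Fin k → Fin m} {κ κ' : Fin k → Fin n} (hι : Function.Injective ι)
    (hι' : Function.Injective ι') (hκ : Function.Injective κ) (hκ' : Function.Injective κ')
    (h : FlagUpTo (initialSet ι) (initialSet κ) k x)
    (h' : FlagUpTo (initialSet ι') (initialSet κ') k x) : ι = ι' ∧ κ = κ' := by
  have key : ∀ l ≤ k, initialSet ι l = initialSet ι' l ∧ initialSet κ l = initialSet κ' l := by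
    intro l hl
    obtain ⟨S, hS⟩ := exists_minAssignF (hl.trans hm) (hl.trans hn) x
    exact ⟨(h l hl S hS).1.symm.trans (h' l hl S hS).1,
      (h l hl S hS).2.symm.trans (h' l hl S hS).2⟩
  exact ⟨eq_of_initialSet_eq hι hι' fun l hl => (key l hl).1,
    eq_of_initialSet_eq hκ hκ' fun l hl => (key l hl).2⟩

lemma measureReal_eq_sum_prSeq {m n k : ℕ} {r : Fin m → ℝ} {c : Fin n → ℝ} (hr : ∀ i, 0 < r i)
    (hc : ∀ j, 0 < c j) (hm : k ≤ m) (hn : k ≤ n) (P : (Fin k → Fin m) → Prop) [DecidablePred P]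
    (Q : (Fin k → Fin n) → Prop) [DecidablePred Q] {B : Set (Fin m × Fin n → ℝ)}
    (hB : ∀ x ι κ, FlagUpTo (initialSet ι) (initialSet κ) k x → (x ∈ B ↔ P ι ∧ Q κ)) :
    (rankOneMeasure m n r c).real B =
      (∑ ι with Function.Injective ι ∧ P ι, prSeq r ι) *
        ∑ κ with Function.Injective κ ∧ Q κ, prSeq c κ := by
  have := isProbabilityMeasure_rankOneMeasure hr hc
  rw [Finset.sum_mul_sum, ← Finset.sum_product']
  rw [measureReal_eq_sum
    ((Finset.univ.filter fun ι : Fin k → Fin m => Function.Injective ι ∧ P ι) ×ˢ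
      (Finset.univ.filter fun κ : Fin k → Fin n => Function.Injective κ ∧ Q κ))
    (E := fun p => {x | FlagUpTo (initialSet p.1) (initialSet p.2) k x})
    (fun p _ => measurableSet_flagUpTo _ _ _)]
  · refine Finset.sum_congr rfl fun p hp => ?_
    simp only [Finset.mem_product, Finset.mem_filter, Finset.mem_univ, true_and] at hp
    exact measureReal_flagUpTo_initialSet hr hc hm hn hp.1.1 hp.2.1
  · filter_upwards [ae_rankOneMeasure_genericMatrix r c] with x hx
    simp only [Finset.mem_product, Finset.mem_filter, Finset.mem_univ, true_and]
    constructor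
    · intro hxB
      obtain ⟨ι, κ, hι, hκ, h⟩ := hx.exists_flagUpTo_initialSet hm hn
      have hPQ := (hB x ι κ h).1 hxB
      exact ⟨(ι, κ), ⟨⟨hι, hPQ.1⟩, hκ, hPQ.2⟩, h⟩
    · rintro ⟨p, hp, h⟩
      exact (hB x p.1 p.2 h).2 ⟨hp.1.2, hp.2.2⟩
  · refine Filter.Eventually.of_forall fun x p hp q hq h h' => ?_
    simp only [Finset.mem_product, Finset.mem_filter, Finset.mem_univ, true_and] at hp hq
    have := FlagUpTo.initialSet_inj hm hn hp.1.1 hq.1.1 hp.2.1 hq.2.1 h h'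
    exact Prod.ext this.1 this.2

lemma sum_prSeq_eq_one {m k : ℕ} {r : Fin m → ℝ} (hr : ∀ i, 0 < r i) (hm : k ≤ m) :
    ∑ ι : Fin k → Fin m with Function.Injective ι, prSeq r ι = 1 := by
  induction k with
  | zero => simp [prSeq, Function.injective_of_subsingleton]
  | succ k ih =>
    rw [← ih (by omega), Finset.sum_filter, Finset.sum_filter,
      ← (Fin.snocEquiv fun _ : Fin (k + 1) => Fin m).sum_comp, Fintype.sum_prod_type_right]
    refine Finset.sum_congr rfl fun ι _ => ?_
    have hsnoc : ∀ i, Fin.snocEquiv (fun _ : Fin (k + 1) => Fin m) (i, ι) ∘ Fin.castSucc = ι :=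
      fun i => by
        funext s
        simp [Fin.snocEquiv]
    have hlast : ∀ i, Fin.snocEquiv (fun _ : Fin (k + 1) => Fin m) (i, ι) (Fin.last k) = i :=
      fun i => by simp [Fin.snocEquiv]
    by_cases hι : Function.Injective ι
    · have hcompl : (initialSet ι k)ᶜ.Nonempty := by
        rw [← Finset.card_pos, Finset.card_compl, initialSet_self,
          Finset.card_image_of_injective _ hι]
        simp
        omega
      have hterm : ∀ i, (if Function.Injective (Fin.snocEquiv (fun _ : Fin (k + 1) => Fin m) (i, ι))
          then prSeq r (Fin.snocEquiv (fun _ : Fin (k + 1) => Fin m) (i, ι)) else 0) =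
          if i ∈ (initialSet ι k)ᶜ then
            prSeq r ι * (r i / ∑ a ∈ (initialSet ι k)ᶜ, r a) else 0 := by
        intro i
        by_cases hi : i ∈ (initialSet ι k)ᶜ
        · have hinj : Function.Injective (Fin.snocEquiv (fun _ : Fin (k + 1) => Fin m) (i, ι)) := by
            rw [injective_iff_castSucc, hsnoc, hlast]
            exact ⟨hι, Finset.mem_compl.1 hi⟩
          rw [if_pos hi, if_pos hinj, prSeq_succ r hinj, hsnoc, hlast]
        · rw [if_neg hi, if_neg]
          rw [injective_iff_castSucc, hsnoc, hlast]
          exact fun h => hi (Finset.mem_compl.2 h.2)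
      rw [if_pos hι, Finset.sum_congr rfl fun i _ => hterm i, Finset.sum_ite_mem,
        Finset.univ_inter, ← Finset.mul_sum, ← Finset.sum_div,
        div_self (Finset.sum_pos (fun a _ => hr a) hcompl).ne', mul_one]
    · rw [if_neg hι]
      refine Finset.sum_eq_zero fun i _ => if_neg ?_
      rw [injective_iff_castSucc, hsnoc]
      exact fun h => hι h.1

lemma prSet_eq_sum {m k : ℕ} (r : Fin m → ℝ) {I : Finset (Fin m)} (hI : I.card = k) :
    prSet r I =
      ∑ ι : Fin k → Fin m with Function.Injective ι ∧ Finset.univ.image ι = I, prSeq r ι := by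
  subst hI
  rw [prSet, Finset.sum_filter]

lemma FlagUpTo.forall_minAssignF_iff {m n k : ℕ} (hm : k ≤ m) (hn : k ≤ n)
    {I : ℕ → Finset (Fin m)} {J : ℕ → Finset (Fin n)} {x : Fin m × Fin n → ℝ}
    (h : FlagUpTo I J k x) (p : Finset (Fin m) → Finset (Fin n) → Prop) :
    (∀ S, MinAssignF m n k x S → p (S.image Prod.fst) (S.image Prod.snd)) ↔ p (I k) (J k) := by
  constructor
  · intro hp
    obtain ⟨S, hS⟩ := exists_minAssignF hm hn x
    rw [← (h k le_rfl S hS).1, ← (h k le_rfl S hS).2]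
    exact hp S hS
  · intro hp S hS
    rwa [(h k le_rfl S hS).1, (h k le_rfl S hS).2]

/-- The flag probabilities for a random exponential matrix with rank 1 rate matrix:
the probability of each flag of nested minimum assignments factors, the rows used by
the minimum `k`-assignment have probability `Pr(r,I)`, the columns have probability
`Pr(c,J)`, and the row set and column set are independent. -/
theorem flag_probabilities (k m n : ℕ) (hk : 0 < k) (hkm : k ≤ m) (hmn : m ≤ n)
    (r : Fin m → ℝ) (c : Fin n → ℝ) (hr : ∀ i, 0 < r i) (hc : ∀ j, 0 < c j) :
    (∀ (ι : Fin k → Fin m) (κ : Fin k → Fin n),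
      Function.Injective ι → Function.Injective κ →
      rankOneMeasure m n r c
        {x | ∀ l ≤ k, ∀ S, MinAssignF m n l x S →
          S.image Prod.fst = (Finset.univ.filter fun s : Fin k => (s : ℕ) < l).image ι ∧
          S.image Prod.snd = (Finset.univ.filter fun s : Fin k => (s : ℕ) < l).image κ}
        = ENNReal.ofReal (prSeq r ι * prSeq c κ))
    ∧ (∀ I : Finset (Fin m), I.card = k →
        rankOneMeasure m n r c {x | ∀ S, MinAssignF m n k x S → S.image Prod.fst = I}
          = ENNReal.ofReal (prSet r I))
    ∧ (∀ J : Finset (Fin n), J.card = k →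
        rankOneMeasure m n r c {x | ∀ S, MinAssignF m n k x S → S.image Prod.snd = J}
          = ENNReal.ofReal (prSet c J))
    ∧ (∀ (I : Finset (Fin m)) (J : Finset (Fin n)), I.card = k → J.card = k →
        rankOneMeasure m n r c
          ({x | ∀ S, MinAssignF m n k x S → S.image Prod.fst = I} ∩
            {x | ∀ S, MinAssignF m n k x S → S.image Prod.snd = J})
          = rankOneMeasure m n r c {x | ∀ S, MinAssignF m n k x S → S.image Prod.fst = I}
            * rankOneMeasure m n r c {x | ∀ S, MinAssignF m n k x S → S.image Prod.snd = J}) := by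
  have hkn := hkm.trans hmn
  have := isProbabilityMeasure_rankOneMeasure hr hc
  have hrow : ∀ I : Finset (Fin m), I.card = k →
      (rankOneMeasure m n r c).real {x | ∀ S, MinAssignF m n k x S → S.image Prod.fst = I} =
        prSet r I := by
    intro I hI
    rw [measureReal_eq_sum_prSeq hr hc hkm hkn (fun ι => Finset.univ.image ι = I) (fun _ => True)
      fun x ι κ h => ?_]
    · simp only [and_true]
      rw [sum_prSeq_eq_one hc hkn, mul_one, prSet_eq_sum r hI]
    · rw [and_true, ← initialSet_self]
      exact h.forall_minAssignF_iff hkm hkn fun A _ => A = I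
  have hcol : ∀ J : Finset (Fin n), J.card = k →
      (rankOneMeasure m n r c).real {x | ∀ S, MinAssignF m n k x S → S.image Prod.snd = J} =
        prSet c J := by
    intro J hJ
    rw [measureReal_eq_sum_prSeq hr hc hkm hkn (fun _ => True) (fun κ => Finset.univ.image κ = J)
      fun x ι κ h => ?_]
    · simp only [and_true]
      rw [sum_prSeq_eq_one hr hkm, one_mul, prSet_eq_sum c hJ]
    · rw [true_and, ← initialSet_self]
      exact h.forall_minAssignF_iff hkm hkn fun _ B => B = J
  refine ⟨fun ι κ hι hκ => ?_, fun I hI => ?_, fun J hJ => ?_, fun I J hI hJ => ?_⟩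
  · rw [← measureReal_flagUpTo_initialSet hr hc hkm hkn hι hκ, ofReal_measureReal]
    rfl
  · rw [← hrow I hI, ofReal_measureReal]
  · rw [← hcol J hJ, ofReal_measureReal]
  · rw [← ofReal_measureReal, ← ofReal_measureReal, ← ofReal_measureReal,
      ← ENNReal.ofReal_mul measureReal_nonneg, hrow I hI, hcol J hJ,
      measureReal_eq_sum_prSeq hr hc hkm hkn (fun ι => Finset.univ.image ι = I)
        (fun κ => Finset.univ.image κ = J) fun x ι κ h => ?_, ← prSet_eq_sum r hI,
      ← prSet_eq_sum c hJ]
    rw [← initialSet_self, ← initialSet_self]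
    exact and_congr (h.forall_minAssignF_iff hkm hkn fun A _ => A = I)
      (h.forall_minAssignF_iff hkm hkn fun _ B => B = J)
end

section
/- Let k ≤ m ≤ n and fix an index i with 1 ≤ i ≤ m. On the open set where all r_1,…,r_m and c_1,…,c_n are positive, the function F(k,r,c) is differentiable to every order ℓ ≥ 0 in the variable r_i, and (−1)^ℓ · ∂^ℓ F/∂r_i^ℓ > 0 for every ℓ ≥ 0. In particular, F(k,r,c) is positive and strictly decreasing in each r_i (and, by symmetry, in each c_j). -/
/-- The conjectured formula `F(k,r,c)` for the expected minimum `k`-assignment of a random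
exponential matrix with rank 1 rate matrix `(r i * c j)`: the sum over proper subsets
`I ⊊ {1,…,m}` and `J ⊊ {1,…,n}` with `|I| + |J| < k` of
`(−1)^{k−1−|I|−|J|} · C(m+n−1−|I|−|J|, k−1−|I|−|J|) / ((∑_{i∉I} r i)(∑_{j∉J} c j))`. -/
noncomputable def F (k : ℕ) {m n : ℕ} (r : Fin m → ℝ) (c : Fin n → ℝ) : ℝ :=
  ∑ I : Finset (Fin m), ∑ J : Finset (Fin n),
    if I ≠ Finset.univ ∧ J ≠ Finset.univ ∧ I.card + J.card < k then
      (-1 : ℝ) ^ (k - 1 - I.card - J.card) *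
        ((m + n - 1 - I.card - J.card).choose (k - 1 - I.card - J.card) : ℝ) /
        ((∑ i ∈ Iᶜ, r i) * (∑ j ∈ Jᶜ, c j))
    else 0

open Finset in
/-- Inclusion–exclusion expression for the probability that exactly `k` of the independent events
indexed by `s` occur, when the event `i` fails with probability `w i`. -/
noncomputable def exactCountSum {ι : Type*} [DecidableEq ι] (w : ι → ℝ) (s : Finset ι) (k : ℕ) :
    ℝ :=
  ∑ S ∈ s.powerset, if #S ≤ k then
    (-1 : ℝ) ^ (k - #S) * ((#s - #S).choose (k - #S) : ℝ) * ∏ i ∈ s \ S, w i else 0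

open Finset in
/-- Inclusion–exclusion expression for the probability that fewer than `k` of the independent
events indexed by `s` occur, when the event `i` fails with probability `w i`. -/
noncomputable def lowerCountSum {ι : Type*} [DecidableEq ι] (w : ι → ℝ) (s : Finset ι) (k : ℕ) :
    ℝ :=
  ∑ S ∈ s.powerset, if #S < k then
    (-1 : ℝ) ^ (k - 1 - #S) * ((#s - 1 - #S).choose (k - 1 - #S) : ℝ) * ∏ i ∈ s \ S, w i else 0

section Counting

open Finset

variable {ι : Type*} [DecidableEq ι] {w : ι → ℝ} {s : Finset ι} {a : ι}

theorem exactCountSum_insert_zero (ha : a ∉ s) :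
    exactCountSum w (insert a s) 0 = w a * exactCountSum w s 0 := by
  unfold exactCountSum
  rw [sum_powerset_insert ha, mul_sum]
  rw [sum_eq_zero (s := s.powerset) (f := fun t => ite (#(insert a t) ≤ 0) _ _), add_zero]
  · refine sum_congr rfl fun S hS => ?_
    have haS : a ∉ S := fun h => ha (mem_powerset.1 hS h)
    rw [insert_sdiff_of_notMem _ haS, prod_insert (by simp [ha])]
    split_ifs with h
    · simp at h
      simp [h]
    · simp
  · intro S hS
    simp

theorem exactCountSum_insert_succ (ha : a ∉ s) (k : ℕ) :
    exactCountSum w (insert a s) (k + 1) =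
      w a * exactCountSum w s (k + 1) + (1 - w a) * exactCountSum w s k := by
  unfold exactCountSum
  rw [sum_powerset_insert ha, mul_sum, mul_sum, ← sum_add_distrib, ← sum_add_distrib]
  refine sum_congr rfl fun S hS => ?_
  have hSs := mem_powerset.1 hS
  have haS : a ∉ S := fun h => ha (hSs h)
  have hcard := card_le_card hSs
  rw [insert_sdiff_of_notMem _ haS, prod_insert (by simp [ha]), insert_sdiff_insert,
    sdiff_insert_of_notMem ha, card_insert_of_notMem ha, card_insert_of_notMem haS]
  obtain ⟨p, hp⟩ := Nat.exists_eq_add_of_le hcard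
  rcases lt_trichotomy (#S) (k + 1) with h | h | h
  · obtain ⟨q, rfl⟩ := Nat.exists_eq_add_of_le (Nat.lt_succ_iff.1 h)
    rw [if_pos (by omega), if_pos (by omega), if_pos (by omega), if_pos (by omega),
      show #S + q + 1 - #S = q + 1 by omega, show #S + q + 1 - (#S + 1) = q by omega,
      show #S + q - #S = q by omega, show #s + 1 - #S = p + 1 by omega,
      show #s + 1 - (#S + 1) = p by omega, show #s - #S = p by omega, Nat.choose_succ_succ]
    push_cast
    ring
  · rw [if_pos (by omega), if_neg (by omega), if_pos (by omega), if_neg (by omega), h]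
    simp
  · rw [if_neg (by omega), if_neg (by omega), if_neg (by omega), if_neg (by omega)]
    simp

theorem lowerCountSum_insert_succ (ha : a ∉ s) (k : ℕ) :
    lowerCountSum w (insert a s) (k + 1) = w a * exactCountSum w s k + lowerCountSum w s k := by
  unfold lowerCountSum exactCountSum
  rw [sum_powerset_insert ha, mul_sum]
  congr 1
  · refine sum_congr rfl fun S hS => ?_
    have haS : a ∉ S := fun h => ha (mem_powerset.1 hS h)
    rw [insert_sdiff_of_notMem _ haS, prod_insert (by simp [ha]), card_insert_of_notMem ha]
    simp only [Nat.lt_succ_iff, Nat.add_sub_cancel]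
    split_ifs <;> ring
  · refine sum_congr rfl fun S hS => ?_
    have haS : a ∉ S := fun h => ha (mem_powerset.1 hS h)
    rw [insert_sdiff_insert, sdiff_insert_of_notMem ha, card_insert_of_notMem ha,
      card_insert_of_notMem haS, show k + 1 - 1 - (#S + 1) = k - 1 - #S by omega,
      show #s + 1 - 1 - (#S + 1) = #s - 1 - #S by omega]
    simp only [Nat.add_lt_add_iff_right]

theorem exactCountSum_nonneg (hw : ∀ i, 0 < w i) (hw' : ∀ i, w i < 1) (s : Finset ι) (k : ℕ) :
    0 ≤ exactCountSum w s k := by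
  induction s using Finset.induction_on generalizing k with
  | empty => cases k <;> simp [exactCountSum]
  | insert a s ha ih =>
    cases k with
    | zero =>
      rw [exactCountSum_insert_zero ha]
      exact mul_nonneg (hw a).le (ih 0)
    | succ k =>
      rw [exactCountSum_insert_succ ha]
      exact add_nonneg (mul_nonneg (hw a).le (ih _)) (mul_nonneg (sub_pos.2 (hw' a)).le (ih _))

theorem exactCountSum_pos (hw : ∀ i, 0 < w i) (hw' : ∀ i, w i < 1) {k : ℕ} (hk : k ≤ #s) :
    0 < exactCountSum w s k := by
  induction s using Finset.induction_on generalizing k with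
  | empty =>
    obtain rfl : k = 0 := by simpa using hk
    simp [exactCountSum]
  | insert a s ha ih =>
    cases k with
    | zero =>
      rw [exactCountSum_insert_zero ha]
      exact mul_pos (hw a) (ih (Nat.zero_le _))
    | succ k =>
      rw [card_insert_of_notMem ha] at hk
      rw [exactCountSum_insert_succ ha]
      exact add_pos_of_nonneg_of_pos
        (mul_nonneg (hw a).le (exactCountSum_nonneg hw hw' _ _))
        (mul_pos (sub_pos.2 (hw' a)) (ih (by omega)))

theorem lowerCountSum_zero : lowerCountSum w s 0 = 0 := by
  simp [lowerCountSum]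

theorem lowerCountSum_nonneg (hw : ∀ i, 0 < w i) (hw' : ∀ i, w i < 1) {k : ℕ} (hk : k ≤ #s) :
    0 ≤ lowerCountSum w s k := by
  induction s using Finset.induction_on generalizing k with
  | empty =>
    obtain rfl : k = 0 := by simpa using hk
    exact lowerCountSum_zero.ge
  | insert a s ha ih =>
    cases k with
    | zero => exact lowerCountSum_zero.ge
    | succ k =>
      rw [card_insert_of_notMem ha] at hk
      rw [lowerCountSum_insert_succ ha]
      exact add_nonneg (mul_nonneg (hw a).le (exactCountSum_nonneg hw hw' _ _)) (ih (by omega))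

theorem lowerCountSum_pos (hw : ∀ i, 0 < w i) (hw' : ∀ i, w i < 1) {k : ℕ} (hk : 0 < k)
    (hks : k ≤ #s) : 0 < lowerCountSum w s k := by
  obtain ⟨k, rfl⟩ := Nat.exists_eq_succ_of_ne_zero hk.ne'
  obtain ⟨a, ha⟩ := card_pos.1 (hk.trans_le hks)
  rw [← insert_erase ha, lowerCountSum_insert_succ (notMem_erase a s)]
  have hcard := card_erase_of_mem ha
  exact add_pos_of_pos_of_nonneg
    (mul_pos (hw a) (exactCountSum_pos hw hw' (by omega)))
    (lowerCountSum_nonneg hw hw' (by omega))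

end Counting

section Laplace

open MeasureTheory Set Real

theorem integral_pow_mul_exp_neg_mul_Ioi {ρ : ℝ} (hρ : 0 < ρ) (ℓ : ℕ) :
    ∫ x in Ioi (0 : ℝ), x ^ ℓ * exp (-(ρ * x)) = ℓ.factorial / ρ ^ (ℓ + 1) := by
  have h := integral_rpow_mul_exp_neg_mul_Ioi (a := ℓ + 1) (by positivity) hρ
  rw [Gamma_nat_eq_factorial] at h
  simp only [add_sub_cancel_right, rpow_natCast] at h
  rw [h, ← Nat.cast_add_one, rpow_natCast, div_pow, one_pow]
  ring

theorem integrableOn_pow_mul_exp_neg_mul_Ioi {ρ : ℝ} (hρ : 0 < ρ) (ℓ : ℕ) :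
    IntegrableOn (fun x => x ^ ℓ * exp (-(ρ * x))) (Ioi 0) := by
  refine Integrable.of_integral_ne_zero ?_
  rw [integral_pow_mul_exp_neg_mul_Ioi hρ]
  positivity

/-- A finite exponential sum which is positive on `(0, ∞)` has positive moments. -/
theorem sum_factorial_div_pow_pos {κ : Type*} {T : Finset κ} {b ρ : κ → ℝ}
    (hρ : ∀ i ∈ T, 0 < ρ i) (h : ∀ x > 0, 0 < ∑ i ∈ T, b i * exp (-(ρ i * x))) (ℓ : ℕ) :
    0 < ∑ i ∈ T, b i * (ℓ.factorial / ρ i ^ (ℓ + 1)) := by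
  have hint : ∀ i ∈ T, IntegrableOn (fun x => b i * (x ^ ℓ * exp (-(ρ i * x)))) (Ioi 0) :=
    fun i hi => (integrableOn_pow_mul_exp_neg_mul_Ioi (hρ i hi) ℓ).const_mul _
  have heq : ∑ i ∈ T, b i * (ℓ.factorial / ρ i ^ (ℓ + 1)) =
      ∫ x in Ioi (0 : ℝ), ∑ i ∈ T, b i * (x ^ ℓ * exp (-(ρ i * x))) := by
    rw [integral_finsetSum _ hint]
    refine Finset.sum_congr rfl fun i hi => ?_
    rw [integral_const_mul, integral_pow_mul_exp_neg_mul_Ioi (hρ i hi)]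
  have hpos : ∀ x ∈ Ioi (0 : ℝ), 0 < ∑ i ∈ T, b i * (x ^ ℓ * exp (-(ρ i * x))) := by
    intro x hx
    have := mul_pos (pow_pos hx ℓ) (h x hx)
    rw [Finset.mul_sum] at this
    exact this.trans_eq (Finset.sum_congr rfl fun i _ => by ring)
  rw [heq, setIntegral_pos_iff_support_of_nonneg_ae
    ((ae_restrict_mem measurableSet_Ioi).mono fun x hx => (hpos x hx).le)
    (integrable_finsetSum _ hint),
    inter_eq_right.2 fun x hx => Function.mem_support.2 (hpos x hx).ne']
  simp

theorem sum_factorial_div_pow_mul_pos {κ : Type*} {T : Finset κ} {b ρ γ : κ → ℝ}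
    (hρ : ∀ i ∈ T, 0 < ρ i) (hγ : ∀ i ∈ T, 0 < γ i)
    (h : ∀ x > 0, ∀ y > 0, 0 < ∑ i ∈ T, b i * (exp (-(ρ i * x)) * exp (-(γ i * y)))) (ℓ : ℕ) :
    0 < ∑ i ∈ T, b i / γ i * (ℓ.factorial / ρ i ^ (ℓ + 1)) := by
  refine sum_factorial_div_pow_pos hρ (fun x hx => ?_) ℓ
  have := sum_factorial_div_pow_pos (b := fun i => b i * exp (-(ρ i * x))) hγ
    (fun y hy => by simpa only [mul_assoc] using h x hx y hy) 0
  refine this.trans_eq (Finset.sum_congr rfl fun i _ => ?_)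
  simp only [Nat.factorial_zero, Nat.cast_one, zero_add, pow_one]
  ring

end Laplace

section Derivatives

variable {κ : Type*} {T : Finset κ} {b d : κ → ℝ} {t : ℝ}

theorem contDiffAt_sum_mul_inv_add (hd : ∀ i ∈ T, t + d i ≠ 0) (K : ℝ) (ℓ : ℕ) :
    ContDiffAt ℝ ℓ (fun s => K + ∑ i ∈ T, b i * (s + d i)⁻¹) t :=
  contDiffAt_const.add <| ContDiffAt.sum fun i hi =>
    contDiffAt_const.mul <| (contDiffAt_id.add contDiffAt_const).inv (hd i hi)

theorem iteratedDeriv_inv_add (ℓ : ℕ) (d t : ℝ) :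
    iteratedDeriv ℓ (fun s : ℝ => (s + d)⁻¹) t =
      (-1) ^ ℓ * (ℓ.factorial / (t + d) ^ (ℓ + 1)) := by
  have h := congrFun (iter_deriv_inv_linear ℓ (1 : ℝ) d) t
  simp only [one_mul, one_pow, mul_one] at h
  rw [iteratedDeriv_eq_iterate, h, show (-1 - ℓ : ℤ) = -((ℓ + 1 : ℕ) : ℤ) by push_cast; ring,
    zpow_neg, zpow_natCast]
  ring

theorem iteratedDeriv_sum_mul_inv_add (hd : ∀ i ∈ T, t + d i ≠ 0) (K : ℝ) {ℓ : ℕ} (hℓ : 0 < ℓ) :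
    (-1) ^ ℓ * iteratedDeriv ℓ (fun s => K + ∑ i ∈ T, b i * (s + d i)⁻¹) t =
      ∑ i ∈ T, b i * (ℓ.factorial / (t + d i) ^ (ℓ + 1)) := by
  have hsmooth : ∀ i ∈ T, ContDiffAt ℝ ℓ (fun s => b i * (s + d i)⁻¹) t := fun i hi =>
    contDiffAt_const.mul <| (contDiffAt_id.add contDiffAt_const).inv (hd i hi)
  rw [iteratedDeriv_const_add hℓ, iteratedDeriv_fun_sum hsmooth, Finset.mul_sum]
  refine Finset.sum_congr rfl fun i _ => ?_
  rw [iteratedDeriv_const_mul_field, iteratedDeriv_inv_add, mul_left_comm, ← mul_assoc ((-1) ^ ℓ),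
    ← mul_pow]
  simp

end Derivatives

section AssignmentFormula

open Finset

variable {k m n : ℕ} {r : Fin m → ℝ} {c : Fin n → ℝ}

/-- The signed binomial weight of `S = I ⊔ J` in `F`. -/
noncomputable def assignmentCoeff (k m n : ℕ) (S : Finset (Fin m ⊕ Fin n)) : ℝ :=
  (-1 : ℝ) ^ (k - 1 - #S) * ((m + n - 1 - #S).choose (k - 1 - #S) : ℝ)

theorem F_eq_sum_disjSum (hkm : k ≤ m) (hmn : m ≤ n) (r : Fin m → ℝ) (c : Fin n → ℝ) :
    F k r c = ∑ S : Finset (Fin m ⊕ Fin n) with #S < k, assignmentCoeff k m n S /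
      ((∑ i ∈ S.toLeftᶜ, r i) * ∑ j ∈ S.toRightᶜ, c j) := by
  unfold F
  rw [← Fintype.sum_prod_type', sum_filter,
    ← (Finset.sumEquiv (α := Fin m) (β := Fin n)).toEquiv.symm.sum_comp]
  refine Fintype.sum_congr _ _ fun ⟨I, J⟩ => ?_
  have hcard : #(I.disjSum J) = #I + #J := card_disjSum _ _
  have hI : #I + #J < k → I ≠ univ := by
    rintro h rfl
    simp at h
    omega
  have hJ : #I + #J < k → J ≠ univ := by
    rintro h rfl
    simp at h
    omega
  have hiff : (I ≠ univ ∧ J ≠ univ ∧ #I + #J < k) ↔ #I + #J < k :=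
    ⟨fun h => h.2.2, fun h => ⟨hI h, hJ h, h⟩⟩
  change _ = if #(I.disjSum J) < k then assignmentCoeff k m n (I.disjSum J) /
    ((∑ i ∈ (I.disjSum J).toLeftᶜ, r i) * ∑ j ∈ (I.disjSum J).toRightᶜ, c j) else 0
  simp only [hiff, assignmentCoeff, hcard, toLeft_disjSum, toRight_disjSum, Nat.sub_sub, add_assoc]

theorem prod_compl_exp (r : Fin m → ℝ) (c : Fin n → ℝ) (x y : ℝ) (S : Finset (Fin m ⊕ Fin n)) :
    ∏ i ∈ univ \ S, Sum.elim (fun i => Real.exp (-(r i * x))) (fun j => Real.exp (-(c j * y))) i =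
      Real.exp (-((∑ i ∈ S.toLeftᶜ, r i) * x)) * Real.exp (-((∑ j ∈ S.toRightᶜ, c j) * y)) := by
  have h : univ \ S = S.toLeftᶜ.disjSum S.toRightᶜ := by
    ext (i | j) <;> simp
  rw [h, prod_disjSum]
  simp only [Sum.elim_inl, Sum.elim_inr]
  rw [← Real.exp_sum, ← Real.exp_sum, sum_neg_distrib, sum_neg_distrib, sum_mul, sum_mul]

theorem exp_weight_pos (r : Fin m → ℝ) (c : Fin n → ℝ) (x y : ℝ) (i : Fin m ⊕ Fin n) :
    0 < Sum.elim (fun i => Real.exp (-(r i * x))) (fun j => Real.exp (-(c j * y))) i := by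
  cases i <;> exact Real.exp_pos _

theorem exp_weight_lt_one (hr : ∀ i, 0 < r i) (hc : ∀ j, 0 < c j) {x y : ℝ} (hx : 0 < x)
    (hy : 0 < y) (i : Fin m ⊕ Fin n) :
    Sum.elim (fun i => Real.exp (-(r i * x))) (fun j => Real.exp (-(c j * y))) i < 1 := by
  cases i with
  | inl i => exact Real.exp_lt_one_iff.2 (neg_lt_zero.2 (mul_pos (hr i) hx))
  | inr j => exact Real.exp_lt_one_iff.2 (neg_lt_zero.2 (mul_pos (hc j) hy))

theorem sum_assignmentCoeff_mul_exp_pos (hk : 0 < k) (hkm : k ≤ m)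
    (hr : ∀ i, 0 < r i) (hc : ∀ j, 0 < c j) {x y : ℝ} (hx : 0 < x) (hy : 0 < y) :
    0 < ∑ S : Finset (Fin m ⊕ Fin n) with #S < k, assignmentCoeff k m n S *
      (Real.exp (-((∑ i ∈ S.toLeftᶜ, r i) * x)) *
        Real.exp (-((∑ j ∈ S.toRightᶜ, c j) * y))) := by
  have h := lowerCountSum_pos (s := univ) (exp_weight_pos r c x y)
    (exp_weight_lt_one hr hc hx hy) hk (by simp; omega)
  refine h.trans_eq ?_
  rw [lowerCountSum, sum_filter, powerset_univ]
  refine sum_congr rfl fun S _ => ?_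
  rw [prod_compl_exp]
  simp [assignmentCoeff]

theorem sum_assignmentCoeff_mul_exp_pos_of_notMem (hk : 0 < k) (hkm : k ≤ m) (i₀ : Fin m)
    (hr : ∀ i, 0 < r i) (hc : ∀ j, 0 < c j) {x y : ℝ} (hx : 0 < x) (hy : 0 < y) :
    0 < ∑ S : Finset (Fin m ⊕ Fin n) with #S < k ∧ Sum.inl i₀ ∉ S, assignmentCoeff k m n S *
      (Real.exp (-((∑ i ∈ S.toLeftᶜ, r i) * x)) *
        Real.exp (-((∑ j ∈ S.toRightᶜ, c j) * y))) := by
  set a : Fin m ⊕ Fin n := Sum.inl i₀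
  have hcard : #(univ.erase a) = m + n - 1 := by simp
  have hpos := exp_weight_pos r c x y
  have h := mul_pos (hpos a) (exactCountSum_pos (s := univ.erase a) (k := k - 1) hpos
    (exp_weight_lt_one hr hc hx hy) (by omega))
  refine h.trans_eq ?_
  have hfilter : (univ : Finset (Finset (Fin m ⊕ Fin n))).filter (fun S => #S < k ∧ a ∉ S) =
      (univ.erase a).powerset.filter (fun S => #S ≤ k - 1) := by
    ext S
    simp only [mem_filter, mem_univ, true_and, mem_powerset, subset_erase, subset_univ]
    have : #S < k ↔ #S ≤ k - 1 := by omega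
    rw [this, and_comm]
  rw [hfilter, sum_filter, exactCountSum, mul_sum, hcard]
  refine sum_congr rfl fun S hS => ?_
  have haS : a ∉ S := (subset_erase.1 (mem_powerset.1 hS)).2
  have hset : univ \ S = insert a (univ.erase a \ S) := by
    rw [← insert_sdiff_of_notMem _ haS, insert_erase (mem_univ a)]
  rw [← prod_compl_exp, hset, prod_insert (by simp), assignmentCoeff]
  split_ifs <;> ring

theorem sum_toLeft_compl_pos (hkm : k ≤ m) (hr : ∀ i, 0 < r i) {S : Finset (Fin m ⊕ Fin n)}
    (hS : #S < k) : 0 < ∑ i ∈ S.toLeftᶜ, r i := by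
  refine sum_pos (fun i _ => hr i) (card_pos.1 ?_)
  have := card_toLeft_le (u := S)
  rw [card_compl, Fintype.card_fin]
  omega

theorem sum_toRight_compl_pos (hkn : k ≤ n) (hc : ∀ j, 0 < c j) {S : Finset (Fin m ⊕ Fin n)}
    (hS : #S < k) : 0 < ∑ j ∈ S.toRightᶜ, c j := by
  refine sum_pos (fun i _ => hc i) (card_pos.1 ?_)
  have := card_toRight_le (u := S)
  rw [card_compl, Fintype.card_fin]
  omega

theorem F_pos (hk : 0 < k) (hkm : k ≤ m) (hmn : m ≤ n) (hr : ∀ i, 0 < r i)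
    (hc : ∀ j, 0 < c j) : 0 < F k r c := by
  rw [F_eq_sum_disjSum hkm hmn]
  have h := sum_factorial_div_pow_mul_pos (b := assignmentCoeff k m n)
    (fun S hS => sum_toLeft_compl_pos hkm hr (mem_filter.1 hS).2)
    (fun S hS => sum_toRight_compl_pos (hkm.trans hmn) hc (mem_filter.1 hS).2)
    (fun x hx y hy => sum_assignmentCoeff_mul_exp_pos hk hkm hr hc hx hy) 0
  refine h.trans_eq (sum_congr rfl fun S _ => ?_)
  simp only [Nat.factorial_zero, Nat.cast_one, zero_add, pow_one]
  rw [div_mul_div_comm, mul_one, mul_comm (∑ j ∈ S.toRightᶜ, c j)]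

theorem sum_update_of_mem_compl {i₀ : Fin m} {S : Finset (Fin m ⊕ Fin n)} (r : Fin m → ℝ)
    (hS : Sum.inl i₀ ∉ S) (s : ℝ) :
    ∑ i ∈ S.toLeftᶜ, Function.update r i₀ s i = s + ∑ i ∈ S.toLeftᶜ \ {i₀}, r i :=
  sum_update_of_mem (by simpa using hS) _ _

theorem F_update_eq (hkm : k ≤ m) (hmn : m ≤ n) (i₀ : Fin m) (r : Fin m → ℝ) (c : Fin n → ℝ) :
    ∃ K : ℝ, (fun s => F k (Function.update r i₀ s) c) = fun s =>
      K + ∑ S : Finset (Fin m ⊕ Fin n) with #S < k ∧ Sum.inl i₀ ∉ S,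
        assignmentCoeff k m n S / (∑ j ∈ S.toRightᶜ, c j) *
          (s + ∑ i ∈ S.toLeftᶜ \ {i₀}, r i)⁻¹ := by
  refine ⟨∑ S : Finset (Fin m ⊕ Fin n) with #S < k ∧ Sum.inl i₀ ∈ S, assignmentCoeff k m n S /
      ((∑ i ∈ S.toLeftᶜ, r i) * ∑ j ∈ S.toRightᶜ, c j), funext fun s => ?_⟩
  rw [F_eq_sum_disjSum hkm hmn, ← sum_filter_add_sum_filter_not _ (fun S => Sum.inl i₀ ∈ S),
    filter_filter, filter_filter]
  congr 1
  · refine sum_congr rfl fun S hS => ?_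
    rw [sum_update_of_notMem (by simpa using (mem_filter.1 hS).2.2)]
  · refine sum_congr rfl fun S hS => ?_
    rw [sum_update_of_mem_compl r (mem_filter.1 hS).2.2, mul_comm, ← div_div,
      div_eq_mul_inv _ (s + _)]

end AssignmentFormula

/-- On the region where all rates are positive, `F(k,r,c)` is differentiable to every
order `ℓ` in each variable `r i₀`, with `(−1)^ℓ ∂^ℓ F/∂r_{i₀}^ℓ > 0`; in particular `F`
is positive and strictly decreasing in each `r i₀`. -/
theorem F_derivatives (k m n : ℕ) (hk : 0 < k) (hkm : k ≤ m) (hmn : m ≤ n)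
    (i₀ : Fin m) (r : Fin m → ℝ) (c : Fin n → ℝ)
    (hr : ∀ i, 0 < r i) (hc : ∀ j, 0 < c j) :
    (∀ t ∈ Set.Ioi (0 : ℝ), ∀ ℓ : ℕ,
      ContDiffAt ℝ ℓ (fun s => F k (Function.update r i₀ s) c) t ∧
      0 < (-1 : ℝ) ^ ℓ *
        iteratedDeriv ℓ (fun s => F k (Function.update r i₀ s) c) t) ∧
    StrictAntiOn (fun s => F k (Function.update r i₀ s) c) (Set.Ioi 0) := by
  have hupd : ∀ t > (0 : ℝ), ∀ i, 0 < Function.update r i₀ t i := by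
    intro t ht i
    rcases eq_or_ne i i₀ with rfl | hi
    · simpa using ht
    · simpa [hi] using hr i
  obtain ⟨K, hK⟩ := F_update_eq hkm hmn i₀ r c
  have hden : ∀ t > (0 : ℝ), ∀ S : Finset (Fin m ⊕ Fin n),
      t + ∑ i ∈ S.toLeftᶜ \ {i₀}, r i ≠ 0 := fun t ht S =>
    (add_pos_of_pos_of_nonneg ht (Finset.sum_nonneg fun i _ => (hr i).le)).ne'
  have hdiff : ∀ t > (0 : ℝ), ∀ ℓ : ℕ,
      ContDiffAt ℝ ℓ (fun s => F k (Function.update r i₀ s) c) t := by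
    intro t ht ℓ
    rw [hK]
    exact contDiffAt_sum_mul_inv_add (fun S _ => hden t ht S) K ℓ
  have hpos : ∀ t > (0 : ℝ), ∀ ℓ : ℕ, 0 < (-1 : ℝ) ^ ℓ *
      iteratedDeriv ℓ (fun s => F k (Function.update r i₀ s) c) t := by
    intro t ht ℓ
    rcases Nat.eq_zero_or_pos ℓ with rfl | hℓ
    · simpa using F_pos hk hkm hmn (hupd t ht) hc
    · rw [hK, iteratedDeriv_sum_mul_inv_add (fun S _ => hden t ht S) K hℓ]
      have h := sum_factorial_div_pow_mul_pos (b := assignmentCoeff k m n)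
        (fun S hS => sum_toLeft_compl_pos hkm (hupd t ht) (Finset.mem_filter.1 hS).2.1)
        (fun S hS => sum_toRight_compl_pos (hkm.trans hmn) hc (Finset.mem_filter.1 hS).2.1)
        (fun x hx y hy =>
          sum_assignmentCoeff_mul_exp_pos_of_notMem hk hkm i₀ (hupd t ht) hc hx hy) ℓ
      refine h.trans_eq (Finset.sum_congr rfl fun S hS => ?_)
      rw [sum_update_of_mem_compl r (Finset.mem_filter.1 hS).2.2]
  refine ⟨fun t ht ℓ => ⟨hdiff t ht ℓ, hpos t ht ℓ⟩,
    strictAntiOn_of_deriv_neg (convex_Ioi 0)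
      (fun t ht => (hdiff t ht 0).continuousAt.continuousWithinAt) fun t ht => ?_⟩
  rw [interior_Ioi] at ht
  simpa [iteratedDeriv_one] using hpos t ht 1
end
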